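/- Let Ω = (a,b) ⊂ ℝ be a bounded open interval. A function u ∈ BV(a,b) ∩ L^∞(a,b) is weakly super-1-harmonic on (a,b) if and only if there exists c ∈ [a,b] such that u⁺ is non-decreasing on (a,c) and non-increasing on (c,b). -/

import Mathlib

open MeasureTheory Set Filter Topology Metric
open scoped RealInnerProductSpace ENNReal

noncomputable section

/-- Euclidean space `ℝⁿ`. -/
abbrev Eu (n : ℕ) : Type := EuclideanSpace ℝ (Fin n)

/-- `(n-1)`-dimensional Hausdorff measure on `ℝⁿ`. -/
def hm (n : ℕ) : Measure (Eu n) := μH[(n : ℝ) - 1]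

/-- Smooth test functions compactly supported in `Ω`. -/
def IsTest {n : ℕ} (Ω : Set (Eu n)) (φ : Eu n → ℝ) : Prop :=
  ContDiff ℝ (⊤ : ℕ∞) φ ∧ HasCompactSupport φ ∧ tsupport φ ⊆ Ω

/-- `σ ∈ L^∞(Ω, ℝⁿ)` with `‖σ‖ ≤ C` a.e. on `Ω`. -/
def Bdd {n : ℕ} (Ω : Set (Eu n)) (σ : Eu n → Eu n) (C : ℝ) : Prop :=
  AEStronglyMeasurable σ (volume.restrict Ω) ∧ ∀ᵐ x ∂(volume.restrict Ω), ‖σ x‖ ≤ C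

/-- `σ ∈ L^∞_loc(Ω, ℝⁿ)`. -/
def LocBdd {n : ℕ} (Ω : Set (Eu n)) (σ : Eu n → Eu n) : Prop :=
  AEStronglyMeasurable σ (volume.restrict Ω) ∧
  ∀ K : Set (Eu n), K ⊆ Ω → IsCompact K → ∃ C : ℝ, ∀ᵐ x ∂(volume.restrict K), ‖σ x‖ ≤ C

/-- scalar `u ∈ L^∞_loc(Ω)`. -/
def LocBddFun {n : ℕ} (Ω : Set (Eu n)) (u : Eu n → ℝ) : Prop :=
  AEStronglyMeasurable u (volume.restrict Ω) ∧
  ∀ K : Set (Eu n), K ⊆ Ω → IsCompact K → ∃ C : ℝ, ∀ᵐ x ∂(volume.restrict K), |u x| ≤ C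

/-- scalar `u ∈ L^∞(Ω)` with bound `C`. -/
def BddFun {n : ℕ} (Ω : Set (Eu n)) (u : Eu n → ℝ) (C : ℝ) : Prop :=
  AEStronglyMeasurable u (volume.restrict Ω) ∧ ∀ᵐ x ∂(volume.restrict Ω), |u x| ≤ C

/-- A measure carried by `Ω` which is finite on compact subsets of `Ω` (Radon on `Ω`). -/
def LocFinOn {n : ℕ} (Ω : Set (Eu n)) (μ : Measure (Eu n)) : Prop :=
  (∀ K : Set (Eu n), K ⊆ Ω → IsCompact K → μ K < ⊤) ∧ μ Ωᶜ = 0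

/-- A finite measure carried by `Ω`. -/
def FinOn {n : ℕ} (Ω : Set (Eu n)) (μ : Measure (Eu n)) : Prop :=
  μ univ < ⊤ ∧ μ Ωᶜ = 0

/-- The (signed) measure `μp - μn` represents `-Div σ` on `Ω`: for every test function `φ`
compactly supported in `Ω` one has `∫_Ω σ·∇φ dx = ∫ φ dμp - ∫ φ dμn`. -/
def RepNegDiv {n : ℕ} (Ω : Set (Eu n)) (σ : Eu n → Eu n) (μp μn : Measure (Eu n)) : Prop :=
  ∀ φ : Eu n → ℝ, IsTest Ω φ →
    ∫ x in Ω, ⟪σ x, gradient φ x⟫ = (∫ x, φ x ∂μp) - ∫ x, φ x ∂μn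

/-- `Div σ ≤ 0` in the sense of distributions on `Ω`. -/
def DivNonpos {n : ℕ} (Ω : Set (Eu n)) (σ : Eu n → Eu n) : Prop :=
  ∀ φ : Eu n → ℝ, IsTest Ω φ → (∀ x, 0 ≤ φ x) → 0 ≤ ∫ x in Ω, ⟪σ x, gradient φ x⟫

/-- The set `A` has Lebesgue density zero at the point `x`. -/
def DensityZeroAt {n : ℕ} (A : Set (Eu n)) (x : Eu n) : Prop :=
  Tendsto (fun r : ℝ => volume (A ∩ ball x r) / volume (ball x r)) (𝓝[>] 0) (𝓝 0)

/-- The upper (approximate) representative `u⁺`: Lebesgue value at approximate continuity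
points, larger jump value at approximate jump points. -/
def upperRep {n : ℕ} (u : Eu n → ℝ) (x : Eu n) : ℝ :=
  sInf {t : ℝ | DensityZeroAt {y | t < u y} x}

/-- The lower (approximate) representative `u⁻`. -/
def lowerRep {n : ℕ} (u : Eu n → ℝ) (x : Eu n) : ℝ :=
  sSup {t : ℝ | DensityZeroAt {y | u y < t} x}

/-- The precise (mean-value) representative `u* = (u⁺ + u⁻)/2`. -/
def preciseRep {n : ℕ} (u : Eu n → ℝ) (x : Eu n) : ℝ := (upperRep u x + lowerRep u x) / 2

/-- `Du = θ·ν` is the gradient measure of `u` on `Ω` with total variation `ν` and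
polar vector `θ` (so `ν = |Du|`). -/
def HasGradMeasure {n : ℕ} (Ω : Set (Eu n)) (u : Eu n → ℝ) (ν : Measure (Eu n))
    (θ : Eu n → Eu n) : Prop :=
  (∀ᵐ x ∂ν, ‖θ x‖ = 1) ∧ ν Ωᶜ = 0 ∧
  ∀ φ : Eu n → ℝ, IsTest Ω φ → ∫ x in Ω, u x • gradient φ x = - ∫ x, φ x • θ x ∂ν

/-- `u ∈ BV_loc(Ω)`. -/
def MemBVLoc {n : ℕ} (Ω : Set (Eu n)) (u : Eu n → ℝ) : Prop :=
  LocallyIntegrableOn u Ω ∧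
  ∃ ν θ, LocFinOn Ω ν ∧ HasGradMeasure Ω u ν θ

/-- `g` is the weak (Sobolev) gradient of `u ∈ W^{1,1}(Ω)`. -/
def HasSobGrad {n : ℕ} (Ω : Set (Eu n)) (u : Eu n → ℝ) (g : Eu n → Eu n) : Prop :=
  IntegrableOn g Ω ∧
  ∀ φ : Eu n → ℝ, IsTest Ω φ → ∫ x in Ω, u x • gradient φ x = - ∫ x in Ω, φ x • g x

/-- `u ∈ W^{1,1}(Ω)`. -/
def MemW11 {n : ℕ} (Ω : Set (Eu n)) (u : Eu n → ℝ) : Prop :=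
  IntegrableOn u Ω ∧ ∃ g, HasSobGrad Ω u g

/-- `u ∈ W^{1,1}_loc(Ω)` with weak gradient `g`. -/
def HasSobGradLoc {n : ℕ} (Ω : Set (Eu n)) (u : Eu n → ℝ) (g : Eu n → Eu n) : Prop :=
  LocallyIntegrableOn g Ω ∧
  ∀ φ : Eu n → ℝ, IsTest Ω φ → ∫ x in Ω, u x • gradient φ x = - ∫ x in Ω, φ x • g x

def MemW11Loc {n : ℕ} (Ω : Set (Eu n)) (u : Eu n → ℝ) : Prop :=
  LocallyIntegrableOn u Ω ∧ ∃ g, HasSobGradLoc Ω u g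

/-- `T` is the interior trace of `u` on `∂Ω`, characterized `H^{n-1}`-a.e. on `∂Ω`
by convergence of interior mean values. -/
def IsIntTrace {n : ℕ} (Ω : Set (Eu n)) (u T : Eu n → ℝ) : Prop :=
  ∀ᵐ x ∂((hm n).restrict (frontier Ω)),
    Tendsto (fun r : ℝ => (∫ y in Ω ∩ ball x r, |u y - T x|) / (volume (ball x r)).toReal)
      (𝓝[>] 0) (𝓝 0)

/-- The domain assumption `H^{n-1}(∂Ω) = P(Ω) < ∞`, in the equivalent form
`𝟙_Ω ∈ BV(ℝⁿ)` with `|D𝟙_Ω| = H^{n-1}⌞∂Ω`. -/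
def DomainAssum {n : ℕ} (Ω : Set (Eu n)) : Prop :=
  hm n (frontier Ω) < ⊤ ∧
  ∃ θ, HasGradMeasure (univ : Set (Eu n)) (Ω.indicator fun _ => (1 : ℝ))
    ((hm n).restrict (frontier Ω)) θ

/-- `g` is the normal trace `σ_n*` of `σ` on `∂Ω`, characterized by the Gauss–Green
formula for `W^{1,1} ∩ L^∞` functions; here `μ = -Div σ ≥ 0`. -/
def IsNormalTrace {n : ℕ} (Ω : Set (Eu n)) (σ : Eu n → Eu n) (μ : Measure (Eu n))
    (g : Eu n → ℝ) : Prop :=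
  ∀ (v : Eu n → ℝ) (gv : Eu n → Eu n) (T : Eu n → ℝ),
    MemW11 Ω v → (∃ C, BddFun Ω v C) → HasSobGrad Ω v gv → IsIntTrace Ω v T →
    ∀ φ : Eu n → ℝ, IsTest (univ : Set (Eu n)) φ →
      (- ∫ x in Ω, v x * ⟪σ x, gradient φ x⟫) + (∫ x, φ x * preciseRep v x ∂μ)
        = (∫ x in Ω, φ x * ⟪σ x, gv x⟫) + ∫ x in frontier Ω, φ x * T x * g x ∂(hm n)

/-- Weakly super-1-harmonic: there is `σ ∈ L^∞` with `|σ| ≤ 1` a.e., `Div σ ≤ 0`,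
and `⟨σ, Du⁺⟩ = |Du|` as measures on `Ω`. -/
def SuperOneHarmonic {n : ℕ} (Ω : Set (Eu n)) (u : Eu n → ℝ) : Prop :=
  MemBVLoc Ω u ∧ LocBddFun Ω u ∧
  ∃ σ : Eu n → Eu n, ∃ μ : Measure (Eu n),
    Bdd Ω σ 1 ∧ DivNonpos Ω σ ∧ RepNegDiv Ω σ μ 0 ∧ LocFinOn Ω μ ∧
    ∃ ν θ, LocFinOn Ω ν ∧ HasGradMeasure Ω u ν θ ∧
      ∀ φ : Eu n → ℝ, IsTest Ω φ →
        (- ∫ x in Ω, u x * ⟪σ x, gradient φ x⟫) + (∫ x, φ x * upperRep u x ∂μ)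
          = ∫ x, φ x ∂ν

/-- Smooth functions compactly supported in the interval `(a, b)`. -/
def TestOn (a b : ℝ) (φ : ℝ → ℝ) : Prop :=
  ContDiff ℝ (⊤ : ℕ∞) φ ∧ HasCompactSupport φ ∧ tsupport φ ⊆ Ioo a b

namespace TestOn

variable {a b : ℝ} {φ ψ : ℝ → ℝ}

lemma eq_zero (h : TestOn a b φ) {x : ℝ} (hx : x ∉ Ioo a b) : φ x = 0 :=
  image_eq_zero_of_notMem_tsupport fun hx' => hx (h.2.2 hx')

lemma deriv_eq_zero (h : TestOn a b φ) {x : ℝ} (hx : x ∉ Ioo a b) : deriv φ x = 0 :=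
  image_eq_zero_of_notMem_tsupport fun hx' => hx (h.2.2 (tsupport_deriv_subset hx'))

lemma continuous (h : TestOn a b φ) : Continuous φ := h.1.continuous

lemma contDiff_deriv (h : TestOn a b φ) : ContDiff ℝ (⊤ : ℕ∞) (deriv φ) :=
  (contDiff_infty_iff_deriv.1 h.1).2

lemma continuous_deriv (h : TestOn a b φ) : Continuous (deriv φ) :=
  h.contDiff_deriv.continuous

lemma hasDerivAt (h : TestOn a b φ) (x : ℝ) : HasDerivAt φ (deriv φ x) x :=
  ((contDiff_infty_iff_deriv.1 h.1).1 x).hasDerivAt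

lemma integrable_deriv (h : TestOn a b φ) : Integrable (deriv φ) :=
  h.continuous_deriv.integrable_of_hasCompactSupport h.2.1.deriv

lemma integrable (h : TestOn a b φ) {μ : Measure ℝ} [IsFiniteMeasureOnCompacts μ] :
    Integrable φ μ :=
  h.continuous.integrable_of_hasCompactSupport h.2.1

lemma exists_bound (h : TestOn a b φ) : ∃ C, ∀ x, ‖φ x‖ ≤ C :=
  h.2.1.exists_bound_of_continuous h.continuous

lemma exists_bound_deriv (h : TestOn a b φ) : ∃ C, ∀ x, ‖deriv φ x‖ ≤ C :=
  h.2.1.deriv.exists_bound_of_continuous h.continuous_deriv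

lemma mono (h : TestOn a b φ) {a' b' : ℝ} (ha : a' ≤ a) (hb : b ≤ b') : TestOn a' b' φ :=
  ⟨h.1, h.2.1, h.2.2.trans (Ioo_subset_Ioo ha hb)⟩

lemma add (h : TestOn a b φ) (h' : TestOn a b ψ) : TestOn a b (fun x => φ x + ψ x) :=
  ⟨h.1.add h'.1, h.2.1.add h'.2.1, (closure_mono (Function.support_add φ ψ)).trans <| by
    rw [closure_union]
    exact union_subset h.2.2 h'.2.2⟩

lemma of_support_subset_Icc {p q : ℝ} (h : ContDiff ℝ (⊤ : ℕ∞) φ)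
    (hs : Function.support φ ⊆ Icc p q) (hp : a < p) (hq : q < b) : TestOn a b φ := by
  have hs' : tsupport φ ⊆ Icc p q := closure_minimal hs isClosed_Icc
  exact ⟨h, isCompact_Icc.of_isClosed_subset (isClosed_tsupport _) hs',
    hs'.trans (Icc_subset_Ioo hp hq)⟩

lemma exists_support_subset_Icc (h : TestOn a b φ) (hab : a < b) :
    ∃ p q, a < p ∧ p < q ∧ q < b ∧ Function.support φ ⊆ Icc p q := by
  rcases (tsupport φ).eq_empty_or_nonempty with he | hne
  · refine ⟨(2 * a + b) / 3, (a + 2 * b) / 3, by linarith, by linarith, by linarith, ?_⟩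
    exact (subset_tsupport φ).trans (he ▸ empty_subset _)
  · have hc : IsCompact (tsupport φ) := h.2.1
    obtain ⟨p, hp, hp'⟩ := hc.exists_isLeast hne
    obtain ⟨q, hq, hq'⟩ := hc.exists_isGreatest hne
    have h1 := h.2.2 hp
    have h2 := h.2.2 hq
    have h3 : p ≤ q := hp' hq
    refine ⟨(a + p) / 2, q, by linarith [h1.1], by linarith [h1.1], h2.2, fun x hx => ?_⟩
    have hx' := subset_tsupport φ hx
    exact ⟨by linarith [hp' hx', h1.1], hq' hx'⟩

lemma integral_deriv_Ici (h : TestOn a b φ) (t : ℝ) : ∫ x in Ici t, deriv φ x = - φ t := by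
  rw [integral_Ici_eq_integral_Ioi]
  exact h.2.1.integral_Ioi_deriv_eq (h.1.of_le (by exact_mod_cast le_top)) t

lemma integral_deriv (h : TestOn a b φ) : ∫ x, deriv φ x = 0 :=
  integral_eq_zero_of_hasDerivAt_of_integrable h.hasDerivAt h.integrable_deriv h.integrable

end TestOn

/-- A mean-zero smooth function compactly supported in `(a, b)` is the derivative of a smooth
function compactly supported in `(a, b)`. -/
lemma TestOn.exists_deriv_eq {a b : ℝ} (hab : a < b) {η : ℝ → ℝ} (h : TestOn a b η)
    (h0 : ∫ x, η x = 0) : ∃ φ, TestOn a b φ ∧ deriv φ = η := by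
  obtain ⟨p, q, hp, hpq, hq, hs⟩ := h.exists_support_subset_Icc hab
  have hd : ∀ x, HasDerivAt (fun x => ∫ t in p..x, η t) (η x) x := fun x =>
    intervalIntegral.integral_hasDerivAt_right (h.continuous.intervalIntegrable _ _)
      (h.continuous.stronglyMeasurableAtFilter _ _) h.continuous.continuousAt
  have hderiv : deriv (fun x => ∫ t in p..x, η t) = η := funext fun x => (hd x).deriv
  refine ⟨fun x => ∫ t in p..x, η t, TestOn.of_support_subset_Icc (p := p) (q := q)
    (contDiff_infty_iff_deriv.2 ⟨fun x => (hd x).differentiableAt, by rw [hderiv]; exact h.1⟩) ?_ hp hq, hderiv⟩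
  intro x hx
  by_contra hx'
  apply hx
  have hz : ∀ t, t ∉ Icc p q → η t = 0 := fun t ht => by
    by_contra h'
    exact ht (hs h')
  rcases lt_or_ge x p with hxp | hxp
  · simp only
    rw [intervalIntegral.integral_symm, intervalIntegral.integral_of_le hxp.le,
      integral_Ioc_eq_integral_Ioo, setIntegral_eq_zero_of_forall_eq_zero, neg_zero]
    intro t ht
    exact hz t fun h => absurd h.1 (not_le.2 ht.2)
  · have hxq : q < x := by
      by_contra h'
      exact hx' ⟨hxp, not_lt.1 h'⟩
    simp only
    rw [intervalIntegral.integral_of_le hxp, ← integral_Icc_eq_integral_Ioc,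
      setIntegral_eq_integral_of_forall_compl_eq_zero, h0]
    intro t ht
    exact hz t fun h => ht ⟨h.1, h.2.trans hxq.le⟩

lemma TestOn.exists_integral_eq_one {a b : ℝ} (hab : a < b) :
    ∃ ψ, TestOn a b ψ ∧ ∫ x, ψ x = 1 := by
  let f : ContDiffBump ((a + b) / 2) := ⟨(b - a) / 8, (b - a) / 4, by linarith, by linarith⟩
  refine ⟨f.normed volume, ⟨f.contDiff_normed, f.hasCompactSupport_normed, ?_⟩, f.integral_normed⟩
  rw [f.tsupport_normed_eq, Real.closedBall_eq_Icc]
  have : f.rOut = (b - a) / 4 := rfl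
  rw [this]
  exact Icc_subset_Ioo (by linarith) (by linarith)

lemma TestOn.setIntegral_mul_deriv {a b : ℝ} {φ : ℝ → ℝ} (h : TestOn a b φ) (f : ℝ → ℝ) :
    ∫ x in Ioo a b, f x * deriv φ x = ∫ x, f x * deriv φ x :=
  setIntegral_eq_integral_of_forall_compl_eq_zero fun x hx => by rw [h.deriv_eq_zero hx, mul_zero]

lemma TestOn.integrableOn_mul_deriv {a b : ℝ} {φ : ℝ → ℝ} (h : TestOn a b φ) {f : ℝ → ℝ}
    (hf : IntegrableOn f (Ioo a b)) : IntegrableOn (fun x => f x * deriv φ x) (Ioo a b) := by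
  obtain ⟨C, hC⟩ := h.exists_bound_deriv
  exact Integrable.mul_bdd (c := C) hf h.continuous_deriv.aestronglyMeasurable (ae_of_all _ hC)

/-- The du Bois-Reymond lemma: a function with vanishing distributional derivative is constant. -/
lemma exists_ae_eq_const_of_integral_mul_deriv_eq_zero {a b : ℝ} (hab : a < b) {f : ℝ → ℝ}
    (hf : IntegrableOn f (Ioo a b))
    (h : ∀ φ, TestOn a b φ → ∫ x in Ioo a b, f x * deriv φ x = 0) :
    ∃ k : ℝ, ∀ᵐ x ∂(volume.restrict (Ioo a b)), f x = k := by
  obtain ⟨ψ, hψ, hψ1⟩ := TestOn.exists_integral_eq_one hab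
  have hinteg : ∀ {η : ℝ → ℝ}, TestOn a b η → IntegrableOn (fun x => f x * η x) (Ioo a b) := by
    intro η hη
    obtain ⟨C, hC⟩ := hη.exists_bound
    exact Integrable.mul_bdd (c := C) hf hη.continuous.aestronglyMeasurable (ae_of_all _ hC)
  refine ⟨∫ x in Ioo a b, f x * ψ x, ?_⟩
  set k := ∫ x in Ioo a b, f x * ψ x with hk
  rw [ae_restrict_iff' measurableSet_Ioo]
  have hfk : IntegrableOn (fun x => f x - k) (Ioo a b) :=
    Integrable.sub hf (integrable_const _)
  have key := isOpen_Ioo.ae_eq_zero_of_integral_contDiff_smul_eq_zero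
    (U := Ioo a b) (μ := volume) (f := fun x => f x - k) hfk.locallyIntegrableOn ?_
  · filter_upwards [key] with x hx hx'
    linarith [hx hx']
  intro η h1 h2 h3
  have hη : TestOn a b η := ⟨h1, h2, h3⟩
  set m := ∫ x, η x with hm
  have hζ : TestOn a b (fun x => η x + (-m) * ψ x) := by
    refine hη.add ⟨contDiff_const.mul hψ.1, hψ.2.1.mul_left, ?_⟩
    exact (closure_mono (Function.support_mul_subset_right _ _)).trans hψ.2.2
  obtain ⟨φ, hφ, hφ'⟩ := hζ.exists_deriv_eq hab (by
    rw [integral_add hη.integrable (hψ.integrable.const_mul _), integral_const_mul, hψ1]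
    ring)
  have h0 := h φ hφ
  rw [hφ'] at h0
  have hm' : ∫ x in Ioo a b, η x = m :=
    setIntegral_eq_integral_of_forall_compl_eq_zero fun x hx => hη.eq_zero hx
  have e1 : ∫ x, η x • (f x - k) = ∫ x in Ioo a b, η x • (f x - k) :=
    (setIntegral_eq_integral_of_forall_compl_eq_zero fun x hx => by simp [hη.eq_zero hx]).symm
  have e2 : ∫ x in Ioo a b, η x • (f x - k) = (∫ x in Ioo a b, f x * η x) - m * k := by
    rw [← hm', ← integral_mul_const, ← integral_sub (hinteg hη) (hη.integrable.integrableOn.mul_const _)]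
    congr 1 with x
    simp only [smul_eq_mul]
    ring
  have e3 : ∫ x in Ioo a b, f x * (η x + (-m) * ψ x) = (∫ x in Ioo a b, f x * η x) - m * k := by
    rw [hk, ← integral_const_mul, ← integral_sub (hinteg hη) ((hinteg hψ).const_mul _)]
    congr 1 with x
    ring
  rw [e1, e2, ← e3, h0]

/-- Finite measures on `(a, b)` are determined by integrals of test functions. -/
lemma measure_ext_of_testOn {a b : ℝ} {A B : Measure ℝ} [IsFiniteMeasure A] [IsFiniteMeasure B]
    (hA : A (Ioo a b)ᶜ = 0) (hB : B (Ioo a b)ᶜ = 0)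
    (h : ∀ φ, TestOn a b φ → ∫ x, φ x ∂A = ∫ x, φ x ∂B) : A = B := by
  have hAl : A ≪ A + B := Measure.AbsolutelyContinuous.rfl.add_right B
  have hBl : B ≪ A + B := add_comm B A ▸ Measure.AbsolutelyContinuous.rfl.add_right A
  have hiA : Integrable (fun x => (A.rnDeriv (A + B) x).toReal) (A + B) :=
    Measure.integrable_toReal_rnDeriv
  have hiB : Integrable (fun x => (B.rnDeriv (A + B) x).toReal) (A + B) :=
    Measure.integrable_toReal_rnDeriv
  have key := isOpen_Ioo.ae_eq_zero_of_integral_contDiff_smul_eq_zero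
    (U := Ioo a b) (μ := A + B)
    (f := fun x => (A.rnDeriv (A + B) x).toReal - (B.rnDeriv (A + B) x).toReal)
    ((hiA.sub hiB).locallyIntegrable.locallyIntegrableOn _) ?_
  · have hU : ∀ᵐ x ∂(A + B), x ∈ Ioo a b := by
      rw [ae_iff]
      change (A + B) (Ioo a b)ᶜ = 0
      simp [hA, hB]
    refine (Measure.withDensity_rnDeriv_eq A (A + B) hAl).symm.trans
      ((withDensity_congr_ae ?_).trans (Measure.withDensity_rnDeriv_eq B (A + B) hBl))
    filter_upwards [key, hU, A.rnDeriv_lt_top (A + B), B.rnDeriv_lt_top (A + B)] with x h1 h2 h3 h4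
    exact (ENNReal.toReal_eq_toReal_iff' h3.ne h4.ne).1 (sub_eq_zero.1 (h1 h2))
  intro φ h1 h2 h3
  have hφ : TestOn a b φ := ⟨h1, h2, h3⟩
  obtain ⟨C, hC⟩ := hφ.exists_bound
  have e1 := integral_rnDeriv_smul (f := φ) hAl
  have e2 := integral_rnDeriv_smul (f := φ) hBl
  simp only [smul_eq_mul] at e1 e2 ⊢
  simp only [mul_sub]
  rw [integral_sub]
  · simp only [mul_comm (φ _)]
    rw [e1, e2, h φ hφ, sub_self]
  · exact hiA.bdd_mul (c := C) hφ.continuous.aestronglyMeasurable (ae_of_all _ hC)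
  · exact hiB.bdd_mul (c := C) hφ.continuous.aestronglyMeasurable (ae_of_all _ hC)

/-- The right-continuous primitive of the measure `θ ν`. -/
def cumul (ν : Measure ℝ) (θ : ℝ → ℝ) (x : ℝ) : ℝ := ∫ t in Iic x, θ t ∂ν

/-- The left-continuous primitive of the measure `θ ν`. -/
def cumulLeft (ν : Measure ℝ) (θ : ℝ → ℝ) (x : ℝ) : ℝ := ∫ t in Iio x, θ t ∂ν

section Cumul

variable {ν μ : Measure ℝ} {θ h : ℝ → ℝ}

lemma measurable_cumul [SFinite ν] (hθ : Measurable θ) : Measurable (cumul ν θ) := by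
  have : cumul ν θ = fun x => ∫ t, {p : ℝ × ℝ | p.2 ≤ p.1}.indicator (fun p => θ p.2) (x, t) ∂ν :=
    funext fun x => (integral_indicator (μ := ν) (f := θ) (measurableSet_Iic (a := x))).symm
  rw [this]
  have hm : StronglyMeasurable ({p : ℝ × ℝ | p.2 ≤ p.1}.indicator (fun p => θ p.2)) :=
    ((hθ.comp measurable_snd).indicator
      (measurableSet_le measurable_snd measurable_fst)).stronglyMeasurable
  exact hm.integral_prod_right'.measurable

lemma measurable_cumulLeft [SFinite ν] (hθ : Measurable θ) : Measurable (cumulLeft ν θ) := by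
  have : cumulLeft ν θ =
      fun x => ∫ t, {p : ℝ × ℝ | p.2 < p.1}.indicator (fun p => θ p.2) (x, t) ∂ν :=
    funext fun x => (integral_indicator (μ := ν) (f := θ) (measurableSet_Iio (a := x))).symm
  rw [this]
  have hm : StronglyMeasurable ({p : ℝ × ℝ | p.2 < p.1}.indicator (fun p => θ p.2)) :=
    ((hθ.comp measurable_snd).indicator
      (measurableSet_lt measurable_snd measurable_fst)).stronglyMeasurable
  exact hm.integral_prod_right'.measurable

lemma norm_cumul_le (hθ : Integrable θ ν) (x : ℝ) : ‖cumul ν θ x‖ ≤ ∫ t, ‖θ t‖ ∂ν :=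
  (norm_integral_le_integral_norm _).trans
    (setIntegral_le_integral hθ.norm (ae_of_all _ fun _ => norm_nonneg _))

lemma norm_cumulLeft_le (hθ : Integrable θ ν) (x : ℝ) : ‖cumulLeft ν θ x‖ ≤ ∫ t, ‖θ t‖ ∂ν :=
  (norm_integral_le_integral_norm _).trans
    (setIntegral_le_integral hθ.norm (ae_of_all _ fun _ => norm_nonneg _))

lemma cumul_eq_cumulLeft_add (hθ : Integrable θ ν) (x : ℝ) :
    cumul ν θ x = cumulLeft ν θ x + ν.real {x} * θ x := by
  have hs : Iic x = Iio x ∪ {x} := by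
    ext y
    simp [le_iff_lt_or_eq]
  rw [cumul, cumulLeft, hs, setIntegral_union (by simp) (measurableSet_singleton x)
    hθ.integrableOn hθ.integrableOn, integral_singleton, smul_eq_mul]

lemma tendsto_cumul_nhdsGT (hθ : Integrable θ ν) (x : ℝ) :
    Tendsto (cumul ν θ) (𝓝[>] x) (𝓝 (cumul ν θ x)) := by
  have e : ∀ y, cumul ν θ y = ∫ t, (Iic y).indicator θ t ∂ν := fun y =>
    (integral_indicator measurableSet_Iic).symm
  rw [e x, funext e]
  refine tendsto_integral_filter_of_dominated_convergence (fun t => ‖θ t‖)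
    (Eventually.of_forall fun y => hθ.aestronglyMeasurable.indicator measurableSet_Iic)
    (Eventually.of_forall fun y => ae_of_all _ fun t => norm_indicator_le_norm_self _ _)
    hθ.norm (ae_of_all _ fun t => ?_)
  refine tendsto_const_nhds.congr' ?_
  rcases le_or_gt t x with htx | htx
  · filter_upwards [self_mem_nhdsWithin] with y hy
    rw [indicator_of_mem (show t ∈ Iic x from htx),
      indicator_of_mem (show t ∈ Iic y from htx.trans (le_of_lt hy))]
  · filter_upwards [mem_nhdsWithin_of_mem_nhds (Iio_mem_nhds htx)] with y hy
    rw [indicator_of_notMem (show t ∉ Iic x from not_le.2 htx),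
      indicator_of_notMem (show t ∉ Iic y from not_le.2 (show y < t from hy))]

lemma tendsto_cumul_nhdsLT (hθ : Integrable θ ν) (x : ℝ) :
    Tendsto (cumul ν θ) (𝓝[<] x) (𝓝 (cumulLeft ν θ x)) := by
  have e : ∀ y, cumul ν θ y = ∫ t, (Iic y).indicator θ t ∂ν := fun y =>
    (integral_indicator measurableSet_Iic).symm
  have e' : cumulLeft ν θ x = ∫ t, (Iio x).indicator θ t ∂ν :=
    (integral_indicator measurableSet_Iio).symm
  rw [e', funext e]
  refine tendsto_integral_filter_of_dominated_convergence (fun t => ‖θ t‖)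
    (Eventually.of_forall fun y => hθ.aestronglyMeasurable.indicator measurableSet_Iic)
    (Eventually.of_forall fun y => ae_of_all _ fun t => norm_indicator_le_norm_self _ _)
    hθ.norm (ae_of_all _ fun t => ?_)
  refine tendsto_const_nhds.congr' ?_
  rcases lt_or_ge t x with htx | htx
  · filter_upwards [mem_nhdsWithin_of_mem_nhds (Ioi_mem_nhds htx)] with y hy
    rw [indicator_of_mem (show t ∈ Iio x from htx),
      indicator_of_mem (show t ∈ Iic y from le_of_lt (show t < y from hy))]
  · filter_upwards [self_mem_nhdsWithin] with y hy
    rw [indicator_of_notMem (show t ∉ Iio x from not_lt.2 htx),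
      indicator_of_notMem (show t ∉ Iic y from not_le.2 (lt_of_lt_of_le hy htx))]

lemma tendsto_cumulLeft_nhdsGT (hθ : Integrable θ ν) (x : ℝ) :
    Tendsto (cumulLeft ν θ) (𝓝[>] x) (𝓝 (cumul ν θ x)) := by
  have e : ∀ y, cumulLeft ν θ y = ∫ t, (Iio y).indicator θ t ∂ν := fun y =>
    (integral_indicator measurableSet_Iio).symm
  have e' : cumul ν θ x = ∫ t, (Iic x).indicator θ t ∂ν :=
    (integral_indicator measurableSet_Iic).symm
  rw [e', funext e]
  refine tendsto_integral_filter_of_dominated_convergence (fun t => ‖θ t‖)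
    (Eventually.of_forall fun y => hθ.aestronglyMeasurable.indicator measurableSet_Iio)
    (Eventually.of_forall fun y => ae_of_all _ fun t => norm_indicator_le_norm_self _ _)
    hθ.norm (ae_of_all _ fun t => ?_)
  refine tendsto_const_nhds.congr' ?_
  rcases le_or_gt t x with htx | htx
  · filter_upwards [self_mem_nhdsWithin] with y hy
    rw [indicator_of_mem (show t ∈ Iic x from htx),
      indicator_of_mem (show t ∈ Iio y from lt_of_le_of_lt htx hy)]
  · filter_upwards [mem_nhdsWithin_of_mem_nhds (Iio_mem_nhds htx)] with y hy
    rw [indicator_of_notMem (show t ∉ Iic x from not_le.2 htx),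
      indicator_of_notMem (show t ∉ Iio y from not_lt.2 (le_of_lt (show y < t from hy)))]

/-- Fubini's theorem on a measurable region of the plane given by a relation. -/
lemma integral_setIntegral_mul_comm [SFinite ν] [SFinite μ] (hθ : Integrable θ ν)
    (hh : Integrable h μ) {S : Set (ℝ × ℝ)} (hS : MeasurableSet S) :
    ∫ x, (∫ t in {t | (x, t) ∈ S}, θ t ∂ν) * h x ∂μ
      = ∫ t, θ t * (∫ x in {x | (x, t) ∈ S}, h x ∂μ) ∂ν := by
  have hinteg : Integrable (S.indicator fun p : ℝ × ℝ => h p.1 * θ p.2) (μ.prod ν) :=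
    (hh.mul_prod hθ).indicator hS
  have hsw := integral_integral_swap (f := fun x t => S.indicator (fun p => h p.1 * θ p.2) (x, t))
    (μ := μ) (ν := ν) hinteg
  have e1 : ∀ x, (∫ t in {t | (x, t) ∈ S}, θ t ∂ν) * h x
      = ∫ t, S.indicator (fun p => h p.1 * θ p.2) (x, t) ∂ν := by
    intro x
    rw [← integral_mul_const, 
      ← integral_indicator (s := {t | (x, t) ∈ S}) (measurable_prodMk_left hS)]
    congr 1 with t
    by_cases ht : (x, t) ∈ S
    · rw [indicator_of_mem (show t ∈ {t | (x, t) ∈ S} from ht), indicator_of_mem ht, mul_comm]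
    · rw [indicator_of_notMem (show t ∉ {t | (x, t) ∈ S} from ht), indicator_of_notMem ht]
  have e2 : ∀ t, θ t * (∫ x in {x | (x, t) ∈ S}, h x ∂μ)
      = ∫ x, S.indicator (fun p => h p.1 * θ p.2) (x, t) ∂μ := by
    intro t
    rw [← integral_const_mul, 
      ← integral_indicator (s := {x | (x, t) ∈ S}) (measurable_prodMk_right hS)]
    congr 1 with x
    by_cases ht : (x, t) ∈ S
    · rw [indicator_of_mem (show x ∈ {x | (x, t) ∈ S} from ht), indicator_of_mem ht, mul_comm]
    · rw [indicator_of_notMem (show x ∉ {x | (x, t) ∈ S} from ht), indicator_of_notMem ht]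
  simp only [e1, e2]
  exact hsw

lemma integral_cumul_mul [SFinite ν] [SFinite μ] (hθ : Integrable θ ν) (hh : Integrable h μ) :
    ∫ x, cumul ν θ x * h x ∂μ = ∫ t, θ t * (∫ x in Ici t, h x ∂μ) ∂ν :=
  integral_setIntegral_mul_comm hθ hh (measurableSet_le measurable_snd measurable_fst)

lemma integral_cumulLeft_mul [SFinite ν] [SFinite μ] (hθ : Integrable θ ν) (hh : Integrable h μ) :
    ∫ x, cumulLeft ν θ x * h x ∂μ = ∫ t, θ t * (∫ x in Ioi t, h x ∂μ) ∂ν :=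
  integral_setIntegral_mul_comm hθ hh (measurableSet_lt measurable_snd measurable_fst)

variable {a b : ℝ} {φ : ℝ → ℝ}

lemma integral_cumul_mul_deriv [SFinite ν] (hθ : Integrable θ ν) (hφ : TestOn a b φ) :
    ∫ x, cumul ν θ x * deriv φ x = - ∫ x, φ x * θ x ∂ν := by
  rw [integral_cumul_mul hθ hφ.integrable_deriv, ← integral_neg]
  congr 1 with t
  rw [hφ.integral_deriv_Ici]
  ring

/-- A function whose distributional derivative on `(a, b)` is `θ ν` agrees a.e. with a primitive
of `θ ν` up to a constant. -/
lemma exists_ae_eq_const_add_cumul [IsFiniteMeasure ν] (hab : a < b) (hθm : Measurable θ)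
    (hθ : Integrable θ ν) {u : ℝ → ℝ} (hu : IntegrableOn u (Ioo a b))
    (h : ∀ φ, TestOn a b φ → ∫ x in Ioo a b, u x * deriv φ x = - ∫ x, φ x * θ x ∂ν) :
    ∃ k : ℝ, ∀ᵐ x ∂(volume.restrict (Ioo a b)), u x = k + cumul ν θ x := by
  have hg : IntegrableOn (cumul ν θ) (Ioo a b) :=
    Integrable.of_bound (measurable_cumul hθm).aestronglyMeasurable _
      (ae_of_all _ (norm_cumul_le hθ))
  obtain ⟨k, hk⟩ := exists_ae_eq_const_of_integral_mul_deriv_eq_zero hab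
    (f := fun x => u x - cumul ν θ x) (hu.sub hg) fun φ hφ => by
      simp only [sub_mul]
      rw [integral_sub (hφ.integrableOn_mul_deriv hu) (hφ.integrableOn_mul_deriv hg), h φ hφ,
        hφ.setIntegral_mul_deriv, integral_cumul_mul_deriv hθ hφ, sub_self]
  refine ⟨k, hk.mono fun x hx => ?_⟩
  linarith

/-- The product rule for a function of bounded variation and a monotone function. -/
lemma integral_mul_mul_deriv [IsFiniteMeasure ν] [IsFiniteMeasure μ] (hθm : Measurable θ)
    (hθ : Integrable θ ν) (hφ : TestOn a b φ) (k l : ℝ) :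
    ∫ x, (k + cumul ν θ x) * (l - cumul μ (fun _ => 1) x) * deriv φ x
      = (∫ x, φ x * (k + cumulLeft ν θ x) ∂μ)
        - ∫ x, φ x * ((l - cumul μ (fun _ => 1) x) * θ x) ∂ν := by
  have h1 : Integrable (fun _ : ℝ => (1 : ℝ)) μ := integrable_const 1
  have hm1 : Measurable (cumul μ fun _ => (1 : ℝ)) := measurable_cumul measurable_const
  obtain ⟨C, hC⟩ := hφ.exists_bound
  set s : ℝ → ℝ := fun x => l - cumul μ (fun _ => 1) x with hs
  have hsm : Measurable s := measurable_const.sub hm1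
  have hsb : ∀ x, ‖s x‖ ≤ ‖l‖ + ∫ t : ℝ, ‖(1 : ℝ)‖ ∂μ := fun x =>
    (norm_sub_le _ _).trans (by gcongr; exact norm_cumul_le h1 x)
  have hsd : Integrable (fun x => s x * deriv φ x) :=
    hφ.integrable_deriv.bdd_mul hsm.aestronglyMeasurable (ae_of_all _ hsb)
  have hgsd : Integrable (fun x => cumul ν θ x * (s x * deriv φ x)) :=
    hsd.bdd_mul (measurable_cumul hθm).aestronglyMeasurable (ae_of_all _ (norm_cumul_le hθ))
  have hcd : Integrable (fun x => cumul μ (fun _ => 1) x * deriv φ x) :=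
    hφ.integrable_deriv.bdd_mul hm1.aestronglyMeasurable (ae_of_all _ (norm_cumul_le h1))
  have hφμ : Integrable φ μ := hφ.integrable
  have tail : ∀ t, ∫ x in Ici t, s x * deriv φ x = (∫ x in Ioi t, φ x ∂μ) - s t * φ t := by
    intro t
    have e1 : ∫ x in Ici t, cumul μ (fun _ => 1) x * deriv φ x
        = ∫ r, - φ (max r t) ∂μ := by
      rw [integral_cumul_mul (μ := volume.restrict (Ici t)) h1 hφ.integrable_deriv.integrableOn]
      congr 1 with r
      rw [Measure.restrict_restrict measurableSet_Ici, Ici_inter_Ici, hφ.integral_deriv_Ici, one_mul]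
    have hmax : Integrable (fun r => φ (max r t)) μ :=
      Integrable.of_bound (hφ.continuous.comp (by fun_prop)).aestronglyMeasurable C
        (ae_of_all _ fun r => hC _)
    have e2 : ∫ r, φ (max r t) ∂μ = cumul μ (fun _ => 1) t * φ t + ∫ x in Ioi t, φ x ∂μ := by
      rw [← integral_add_compl (measurableSet_Iic (a := t)) hmax, compl_Iic, cumul,
        ← integral_mul_const]
      congr 1
      · refine setIntegral_congr_fun measurableSet_Iic fun r hr => ?_
        simp [max_eq_right (show r ≤ t from hr)]
      · refine setIntegral_congr_fun measurableSet_Ioi fun r hr => ?_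
        simp [max_eq_left (le_of_lt (show t < r from hr))]
    have e3 : ∫ x in Ici t, s x * deriv φ x
        = l * (∫ x in Ici t, deriv φ x) - ∫ x in Ici t, cumul μ (fun _ => 1) x * deriv φ x := by
      rw [← integral_const_mul, ← integral_sub (hφ.integrable_deriv.integrableOn.const_mul l)
        hcd.integrableOn]
      congr 1 with x
      simp only [hs]
      ring
    rw [e3, e1, integral_neg, e2, hφ.integral_deriv_Ici]
    simp only [hs]
    ring
  have p1 : ∫ x, s x * deriv φ x = ∫ x, φ x ∂μ := by
    have : ∫ x, s x * deriv φ x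
        = l * (∫ x, deriv φ x) - ∫ x, cumul μ (fun _ => 1) x * deriv φ x := by
      rw [← integral_const_mul, ← integral_sub (hφ.integrable_deriv.const_mul l) hcd]
      congr 1 with x
      simp only [hs]
      ring
    rw [this, hφ.integral_deriv, integral_cumul_mul_deriv h1 hφ]
    simp
  have hL : Integrable (fun x => cumulLeft ν θ x * φ x) μ :=
    hφμ.bdd_mul (measurable_cumulLeft hθm).aestronglyMeasurable (ae_of_all _ (norm_cumulLeft_le hθ))
  have hsφ : Integrable (fun x => φ x * (s x * θ x)) ν :=
    (hθ.bdd_mul hsm.aestronglyMeasurable (ae_of_all _ hsb)).bdd_mul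
      hφ.continuous.aestronglyMeasurable (ae_of_all _ hC)
  have p2 : ∫ x, cumul ν θ x * (s x * deriv φ x)
      = (∫ x, cumulLeft ν θ x * φ x ∂μ) - ∫ x, φ x * (s x * θ x) ∂ν := by
    rw [integral_cumul_mul hθ hsd, integral_cumulLeft_mul hθ hφμ, ← integral_sub _ hsφ]
    · congr 1 with t
      rw [tail]
      ring
    · refine hθ.mul_bdd (c := ∫ t, ‖φ t‖ ∂μ) ?_ (ae_of_all _ fun t => ?_)
      · have : (fun t => ∫ x in Ioi t, φ x ∂μ) = fun t => (∫ x, φ x ∂μ) - cumul μ φ t := by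
          funext t
          rw [← integral_add_compl (measurableSet_Iic (a := t)) hφμ, compl_Iic, cumul]
          ring
        rw [this]
        exact (measurable_const.sub (measurable_cumul hφ.continuous.measurable)).aestronglyMeasurable
      · exact (norm_integral_le_integral_norm _).trans
          (setIntegral_le_integral hφμ.norm (ae_of_all _ fun _ => norm_nonneg _))
  have q1 : ∫ x, (k + cumul ν θ x) * s x * deriv φ x
      = k * (∫ x, s x * deriv φ x) + ∫ x, cumul ν θ x * (s x * deriv φ x) := by
    rw [← integral_const_mul, ← integral_add (hsd.const_mul k) hgsd]
    congr 1 with x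
    ring
  have q2 : ∫ x, φ x * (k + cumulLeft ν θ x) ∂μ
      = k * (∫ x, φ x ∂μ) + ∫ x, cumulLeft ν θ x * φ x ∂μ := by
    rw [← integral_const_mul, ← integral_add (hφμ.const_mul k) hL]
    congr 1 with x
    ring
  rw [q1, q2, p1, p2]
  ring

end Cumul

/-- The upper approximate limit of a function on the real line. -/
def upperLim (w : ℝ → ℝ) (x : ℝ) : ℝ :=
  sInf {t : ℝ | Tendsto (fun r : ℝ => volume ({y | t < w y} ∩ ball x r) / volume (ball x r))
    (𝓝[>] 0) (𝓝 0)}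

lemma not_tendsto_density_zero_of_half {x : ℝ} {A : Set ℝ}
    (h : ∀ᶠ r in 𝓝[>] (0 : ℝ), ENNReal.ofReal r ≤ volume (A ∩ ball x r)) :
    ¬ Tendsto (fun r : ℝ => volume (A ∩ ball x r) / volume (ball x r)) (𝓝[>] 0) (𝓝 0) := by
  intro ht
  have hhalf : ∀ᶠ r in 𝓝[>] (0 : ℝ),
      ENNReal.ofReal (1 / 2) ≤ volume (A ∩ ball x r) / volume (ball x r) := by
    filter_upwards [h, self_mem_nhdsWithin] with r hr hr0
    have hr0 : 0 < r := hr0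
    rw [Real.volume_ball, ENNReal.le_div_iff_mul_le (Or.inl (by simpa using hr0))
      (Or.inl ENNReal.ofReal_ne_top), ← ENNReal.ofReal_mul (by norm_num)]
    convert hr using 2
    ring
  have := ge_of_tendsto ht hhalf
  simp at this

/-- The upper approximate limit at a point where one-sided limits exist is the larger one. -/
lemma upperLim_eq_max {a b : ℝ} {w v : ℝ → ℝ}
    (hw : ∀ᵐ y ∂(volume.restrict (Ioo a b)), w y = v y) {x : ℝ} (hx : x ∈ Ioo a b) {l r : ℝ}
    (hl : Tendsto v (𝓝[<] x) (𝓝 l)) (hr : Tendsto v (𝓝[>] x) (𝓝 r)) :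
    upperLim w x = max l r := by
  rw [ae_restrict_iff' measurableSet_Ioo, ae_iff] at hw
  set N := {y | ¬(y ∈ Ioo a b → w y = v y)} with hN
  have hNmem : ∀ y ∈ Ioo a b, y ∉ N → w y = v y := fun y hy hyN => by
    by_contra h
    exact hyN fun h' => h (h' hy)
  have small : ∀ᶠ ρ in 𝓝[>] (0 : ℝ), ball x ρ ⊆ Ioo a b := by
    obtain ⟨ε, hε, hsub⟩ := Metric.isOpen_iff.1 isOpen_Ioo x hx
    filter_upwards [Ioo_mem_nhdsGT hε] with ρ hρ
    exact (ball_subset_ball hρ.2.le).trans hsub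
  have left : ∀ {P : ℝ → Prop}, (∀ᶠ y in 𝓝[<] x, P y) →
      ∀ᶠ ρ in 𝓝[>] (0 : ℝ), ∀ y ∈ Ioo (x - ρ) x, P y := by
    intro P hP
    obtain ⟨c, hc, hsub⟩ := (mem_nhdsLT_iff_exists_Ioo_subset' (show x - 1 < x by linarith)).1 hP
    have hc : c < x := hc
    filter_upwards [Ioo_mem_nhdsGT (sub_pos.2 hc)] with ρ hρ y hy
    exact hsub ⟨by linarith [hρ.2, hy.1], hy.2⟩
  have right : ∀ {P : ℝ → Prop}, (∀ᶠ y in 𝓝[>] x, P y) →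
      ∀ᶠ ρ in 𝓝[>] (0 : ℝ), ∀ y ∈ Ioo x (x + ρ), P y := by
    intro P hP
    obtain ⟨c, hc, hsub⟩ := (mem_nhdsGT_iff_exists_Ioo_subset' (show x < x + 1 by linarith)).1 hP
    have hc : x < c := hc
    filter_upwards [Ioo_mem_nhdsGT (sub_pos.2 hc)] with ρ hρ y hy
    exact hsub ⟨hy.1, by linarith [hρ.2, hy.2]⟩
  have above : ∀ t, max l r < t →
      Tendsto (fun r : ℝ => volume ({y | t < w y} ∩ ball x r) / volume (ball x r))
        (𝓝[>] 0) (𝓝 0) := by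
    intro t ht
    refine tendsto_const_nhds.congr' ?_
    filter_upwards [small, left (hl.eventually_lt_const ((le_max_left _ _).trans_lt ht)),
      right (hr.eventually_lt_const ((le_max_right _ _).trans_lt ht))] with ρ h1 h2 h3
    have hsub : {y | t < w y} ∩ ball x ρ ⊆ N ∪ {x} := by
      rintro y ⟨hy, hyb⟩
      have hyb' := hyb
      rw [Real.ball_eq_Ioo] at hyb'
      by_contra hcon
      rw [mem_union, not_or, mem_singleton_iff] at hcon
      have hwv := hNmem y (h1 hyb) hcon.1
      have hy : t < w y := hy
      rcases lt_or_gt_of_ne hcon.2 with h | h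
      · linarith [h2 y ⟨hyb'.1, h⟩]
      · linarith [h3 y ⟨h, hyb'.2⟩]
    have : volume ({y | t < w y} ∩ ball x ρ) = 0 :=
      measure_mono_null hsub (measure_union_null hw (by simp))
    rw [this, ENNReal.zero_div]
  have below : ∀ t, t < max l r →
      ¬ Tendsto (fun r : ℝ => volume ({y | t < w y} ∩ ball x r) / volume (ball x r))
        (𝓝[>] 0) (𝓝 0) := by
    intro t ht
    apply not_tendsto_density_zero_of_half
    rcases lt_max_iff.1 ht with h | h
    · filter_upwards [small, left (hl.eventually_const_lt h)] with ρ h1 h2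
      have hsub : Ioo (x - ρ) x \ N ⊆ {y | t < w y} ∩ ball x ρ := by
        rintro y ⟨hy, hyN⟩
        have hρ : 0 < ρ := by linarith [hy.1, hy.2]
        have hyb : y ∈ ball x ρ := by
          rw [Real.ball_eq_Ioo]
          exact ⟨hy.1, by linarith [hy.2]⟩
        exact ⟨by rw [mem_ofPred_eq, hNmem y (h1 hyb) hyN]; exact h2 y hy, hyb⟩
      refine le_trans (le_of_eq ?_) (measure_mono hsub)
      rw [measure_sdiff_null hw, Real.volume_Ioo]
      ring_nf
    · filter_upwards [small, right (hr.eventually_const_lt h)] with ρ h1 h2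
      have hsub : Ioo x (x + ρ) \ N ⊆ {y | t < w y} ∩ ball x ρ := by
        rintro y ⟨hy, hyN⟩
        have hρ : 0 < ρ := by linarith [hy.1, hy.2]
        have hyb : y ∈ ball x ρ := by
          rw [Real.ball_eq_Ioo]
          exact ⟨by linarith [hy.1], hy.2⟩
        exact ⟨by rw [mem_ofPred_eq, hNmem y (h1 hyb) hyN]; exact h2 y hy, hyb⟩
      refine le_trans (le_of_eq ?_) (measure_mono hsub)
      rw [measure_sdiff_null hw, Real.volume_Ioo]
      ring_nf
  rw [upperLim]
  refine csInf_eq_of_forall_ge_of_forall_gt_exists_lt ⟨max l r + 1, above _ (by linarith)⟩ ?_ ?_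
  · intro t ht
    by_contra h
    exact below t (not_le.1 h) ht
  · intro t ht
    obtain ⟨t', h1, h2⟩ := exists_between ht
    exact ⟨t', above t' h1, h2⟩

lemma upperLim_eq_const_add_max {a b k : ℝ} {ν : Measure ℝ} {θ w : ℝ → ℝ} (hθ : Integrable θ ν)
    (hw : ∀ᵐ y ∂(volume.restrict (Ioo a b)), w y = k + cumul ν θ y) {x : ℝ} (hx : x ∈ Ioo a b) :
    upperLim w x = k + max (cumulLeft ν θ x) (cumul ν θ x) := by
  rw [upperLim_eq_max hw hx ((tendsto_cumul_nhdsLT hθ x).const_add k)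
    ((tendsto_cumul_nhdsGT hθ x).const_add k), max_add_add_left]

/-- `f` is non-decreasing up to some point of `[a, b]` and non-increasing afterwards. -/
def UnimodalOn (a b : ℝ) (f : ℝ → ℝ) : Prop :=
  ∃ c ∈ Icc a b, (∀ x y, a < x → x ≤ y → y < c → f x ≤ f y) ∧
    (∀ x y, c < x → x ≤ y → y < b → f y ≤ f x)

section Sign

variable {ν : Measure ℝ} {θ : ℝ → ℝ} {p q ε : ℝ}

lemma mul_cumul_le_of_ae_nonneg (hθ : Integrable θ ν)
    (h : ∀ᵐ t ∂ν, t ∈ Ioo p q → 0 ≤ ε * θ t) {x y : ℝ} (hx : p < x) (hxy : x ≤ y) (hy : y < q) :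
    ε * cumul ν θ x ≤ ε * cumul ν θ y ∧ ε * cumulLeft ν θ x ≤ ε * cumulLeft ν θ y := by
  constructor
  · have hs : Iic y = Iic x ∪ Ioc x y := (Iic_union_Ioc_eq_Iic hxy).symm
    have : 0 ≤ ∫ t in Ioc x y, ε * θ t ∂ν := by
      refine setIntegral_nonneg_of_ae_restrict ?_
      filter_upwards [ae_restrict_of_ae h, ae_restrict_mem measurableSet_Ioc] with t ht ht'
      exact ht ⟨hx.trans ht'.1, ht'.2.trans_lt hy⟩
    rw [integral_const_mul] at this
    rw [cumul, cumul, hs, setIntegral_union _ measurableSet_Ioc hθ.integrableOn hθ.integrableOn]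
    · linarith
    · exact Iic_disjoint_Ioc le_rfl
  · have hs : Iio y = Iio x ∪ Ico x y := (Iio_union_Ico_eq_Iio hxy).symm
    have : 0 ≤ ∫ t in Ico x y, ε * θ t ∂ν := by
      refine setIntegral_nonneg_of_ae_restrict ?_
      filter_upwards [ae_restrict_of_ae h, ae_restrict_mem measurableSet_Ico] with t ht ht'
      exact ht ⟨hx.trans_le ht'.1, ht'.2.trans hy⟩
    rw [integral_const_mul] at this
    rw [cumulLeft, cumulLeft, hs,
      setIntegral_union _ measurableSet_Ico hθ.integrableOn hθ.integrableOn]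
    · linarith
    · exact Set.disjoint_left.2 fun t ht ht' => absurd ht'.1 (not_le.2 ht)

lemma ae_nonneg_of_mul_max_cumul_le [IsFiniteMeasure ν] (hθ : Integrable θ ν)
    (h : ∀ x y, p < x → x ≤ y → y < q →
      ε * max (cumulLeft ν θ x) (cumul ν θ x) ≤ ε * max (cumulLeft ν θ y) (cumul ν θ y)) :
    ∀ᵐ t ∂ν, t ∈ Ioo p q → 0 ≤ ε * θ t := by
  have hlim : ∀ x, Tendsto (fun y => ε * max (cumulLeft ν θ y) (cumul ν θ y)) (𝓝[>] x)
      (𝓝 (ε * cumul ν θ x)) := fun x => by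
    have := ((tendsto_cumulLeft_nhdsGT hθ x).max (tendsto_cumul_nhdsGT hθ x)).const_mul ε
    rwa [max_self] at this
  have h1 : ∀ x y, p < x → x < y → y < q →
      ε * cumul ν θ x ≤ ε * max (cumulLeft ν θ y) (cumul ν θ y) := by
    intro x y hx hxy hy
    refine le_of_tendsto (hlim x) ?_
    filter_upwards [Ioo_mem_nhdsGT hxy] with z hz
    exact h z y (hx.trans hz.1) hz.2.le hy
  have h2 : ∀ x y, p < x → x ≤ y → y < q → ε * cumul ν θ x ≤ ε * cumul ν θ y := by
    intro x y hx hxy hy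
    refine ge_of_tendsto (hlim y) ?_
    filter_upwards [Ioo_mem_nhdsGT hy] with z hz
    exact h1 x z hx (hxy.trans_lt hz.1) hz.2
  have h3 : ∀ x y, p < x → x ≤ y → y < q → ε * cumulLeft ν θ x ≤ ε * cumul ν θ y := by
    intro x y hx hxy hy
    refine le_of_tendsto ((tendsto_cumul_nhdsLT hθ x).const_mul ε) ?_
    filter_upwards [Ioo_mem_nhdsLT hx] with z hz
    exact h2 z y hz.1 (hz.2.le.trans hxy) hy
  have h4 : ∀ x y, p < x → x ≤ y → y < q → 0 ≤ ε * ∫ t in Icc x y, θ t ∂ν := by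
    intro x y hx hxy hy
    have hs : Iic y = Iio x ∪ Icc x y := (Iio_union_Icc_eq_Iic hxy).symm
    have := h3 x y hx hxy hy
    rw [cumulLeft, cumul, hs, setIntegral_union _ measurableSet_Icc hθ.integrableOn
      hθ.integrableOn] at this
    · linarith
    · exact Set.disjoint_left.2 fun t ht ht' => absurd ht'.1 (not_le.2 ht)
  filter_upwards [(Besicovitch.vitaliFamily ν).ae_tendsto_average hθ.locallyIntegrable] with x hx hxpq
  refine ge_of_tendsto ((hx.comp (Besicovitch.tendsto_filterAt ν x)).const_mul ε) ?_
  have hpos : 0 < min (x - p) (q - x) := lt_min (sub_pos.2 hxpq.1) (sub_pos.2 hxpq.2)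
  filter_upwards [Ioo_mem_nhdsGT hpos] with r hr
  have hr1 := hr.2.trans_le (min_le_left _ _)
  have hr2 := hr.2.trans_le (min_le_right _ _)
  rw [Function.comp_apply, setAverage_eq, Real.closedBall_eq_Icc, smul_eq_mul, mul_left_comm]
  exact mul_nonneg (inv_nonneg.2 measureReal_nonneg)
    (h4 _ _ (by linarith) (by linarith [hr.1]) (by linarith))

end Sign

/-- A property holding a.e. on an interval holds arbitrarily close to the right of each point. -/
lemma frequently_nhdsGT_of_ae {a b x : ℝ} (hx : x ∈ Ioo a b) {P : ℝ → Prop}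
    (h : ∀ᵐ y ∂(volume.restrict (Ioo a b)), P y) : ∃ᶠ y in 𝓝[>] x, P y := by
  intro hcon
  rw [ae_restrict_iff' measurableSet_Ioo, ae_iff] at h
  obtain ⟨c, hc, hsub⟩ := (mem_nhdsGT_iff_exists_Ioo_subset' hx.2).1 hcon
  have hsub' : Ioo x (min c b) ⊆ {y | ¬(y ∈ Ioo a b → P y)} := fun y hy h' =>
    hsub ⟨hy.1, hy.2.trans_le (min_le_left _ _)⟩
      (h' ⟨hx.1.trans hy.1, hy.2.trans_le (min_le_right _ _)⟩)
  have := measure_mono_null hsub' h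
  rw [Real.volume_Ioo, ENNReal.ofReal_eq_zero] at this
  linarith [lt_min hc hx.2]

lemma integrable_of_sign {ν : Measure ℝ} [IsFiniteMeasure ν] {θ : ℝ → ℝ} (hθm : Measurable θ)
    (hθ1 : ∀ x, θ x = 1 ∨ θ x = -1) : Integrable θ ν :=
  Integrable.of_bound hθm.aestronglyMeasurable 1
    (ae_of_all _ fun x => by rcases hθ1 x with h | h <;> simp [h])

/-- A function for which some non-increasing `σ` with `|σ| ≤ 1` pairs with its derivative to its
total variation is unimodal. -/
lemma unimodalOn_of_pairing {a b : ℝ} (hab : a < b) {ν μ : Measure ℝ} [IsFiniteMeasure ν]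
    [IsFiniteMeasure μ] (hν : ν (Ioo a b)ᶜ = 0) (hμ : μ (Ioo a b)ᶜ = 0) {θ u σ : ℝ → ℝ}
    (hθm : Measurable θ) (hθ1 : ∀ x, θ x = 1 ∨ θ x = -1) (hu : IntegrableOn u (Ioo a b))
    (hσ : IntegrableOn σ (Ioo a b)) (hσ1 : ∀ᵐ x ∂(volume.restrict (Ioo a b)), |σ x| ≤ 1)
    (hgrad : ∀ φ, TestOn a b φ → ∫ x in Ioo a b, u x * deriv φ x = - ∫ x, φ x * θ x ∂ν)
    (hdiv : ∀ φ, TestOn a b φ → ∫ x in Ioo a b, σ x * deriv φ x = ∫ x, φ x ∂μ)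
    (hpair : ∀ φ, TestOn a b φ → (- ∫ x in Ioo a b, u x * (σ x * deriv φ x))
      + (∫ x, φ x * upperLim u x ∂μ) = ∫ x, φ x ∂ν) :
    UnimodalOn a b (upperLim u) := by
  have hθ : Integrable θ ν := integrable_of_sign hθm hθ1
  have h1 : Integrable (fun _ : ℝ => (1 : ℝ)) μ := integrable_const 1
  obtain ⟨k, hk⟩ := exists_ae_eq_const_add_cumul hab hθm hθ hu hgrad
  obtain ⟨l, hl⟩ := exists_ae_eq_const_add_cumul (ν := μ) (θ := fun _ => -1) hab measurable_const
    (integrable_const _) hσ fun φ hφ => by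
      rw [hdiv φ hφ, ← integral_neg]
      simp
  have hup : ∀ x ∈ Ioo a b, upperLim u x = k + max (cumulLeft ν θ x) (cumul ν θ x) :=
    fun x hx => upperLim_eq_const_add_max hθ hk hx
  have hcm : Measurable (cumul μ fun _ => (1 : ℝ)) := measurable_cumul measurable_const
  set s : ℝ → ℝ := fun x => l - cumul μ (fun _ => 1) x with hs
  have hsm : Measurable s := measurable_const.sub hcm
  have hl' : ∀ᵐ x ∂(volume.restrict (Ioo a b)), σ x = s x := by
    filter_upwards [hl] with x hx
    have : cumul μ (fun _ => (-1 : ℝ)) x = - cumul μ (fun _ => 1) x := by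
      simp only [cumul]
      rw [integral_neg]
    rw [hx, this]
    simp only [hs]
    ring
  have hs1 : ∀ x ∈ Ioo a b, |s x| ≤ 1 := by
    intro x hx
    have hfr : ∃ᶠ y in 𝓝[>] x, |s y| ≤ 1 := by
      refine frequently_nhdsGT_of_ae hx ?_
      filter_upwards [hl', hσ1] with y h1 h2
      rwa [← h1]
    exact le_of_tendsto_of_frequently ((tendsto_cumul_nhdsGT h1 x).const_sub l).abs hfr
  have hcr : ∀ x, cumul μ (fun _ => 1) x = μ.real (Iic x) := fun x => by simp [cumul]
  have hsanti : Antitone s := fun x y hxy => by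
    simp only [hs, hcr]
    have : μ.real (Iic x) ≤ μ.real (Iic y) := measureReal_mono (Iic_subset_Iic.2 hxy)
    linarith
  have hsjump : ∀ x y, y < x → s x + μ.real {x} ≤ s y := fun x y hyx => by
    simp only [hs, hcr]
    have : μ.real (Iic y) + μ.real {x} ≤ μ.real (Iic x) := by
      rw [← measureReal_union (by simpa using hyx) (measurableSet_singleton x)]
      exact measureReal_mono (union_subset (Iic_subset_Iic.2 hyx.le) (by simp))
    linarith
  have hνm : ∀ᵐ x ∂ν, x ∈ Ioo a b := by
    rw [ae_iff]
    exact hν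
  have hμm : ∀ᵐ x ∂μ, x ∈ Ioo a b := by
    rw [ae_iff]
    exact hμ
  have hgm : Measurable (cumul ν θ) := measurable_cumul hθm
  have hgLm : Measurable (cumulLeft ν θ) := measurable_cumulLeft hθm
  have hsb : ∀ᵐ x ∂ν, ‖s x‖ ≤ 1 := hνm.mono fun x hx => hs1 x hx
  have hsθ : Integrable (fun x => s x * θ x) ν := hθ.bdd_mul hsm.aestronglyMeasurable hsb
  have hd1 : Integrable (fun x => 1 - s x * θ x) ν := (integrable_const 1).sub hsθ
  have hgLi : Integrable (cumulLeft ν θ) μ :=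
    Integrable.of_bound hgLm.aestronglyMeasurable _ (ae_of_all _ (norm_cumulLeft_le hθ))
  have hgi : Integrable (cumul ν θ) μ :=
    Integrable.of_bound hgm.aestronglyMeasurable _ (ae_of_all _ (norm_cumul_le hθ))
  have hmaxi : Integrable (fun x => max (cumulLeft ν θ x) (cumul ν θ x)) μ := hgLi.sup hgi
  have hd2 : Integrable (fun x => max (cumulLeft ν θ x) (cumul ν θ x) - cumulLeft ν θ x) μ :=
    hmaxi.sub hgLi
  have hd1m : Measurable (fun x => ENNReal.ofReal (1 - s x * θ x)) :=
    (measurable_const.sub (hsm.mul hθm)).ennreal_ofReal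
  have hd2m : Measurable
      (fun x => ENNReal.ofReal (max (cumulLeft ν θ x) (cumul ν θ x) - cumulLeft ν θ x)) :=
    ((hgLm.max hgm).sub hgLm).ennreal_ofReal
  have hsθ1 : ∀ x ∈ Ioo a b, 0 ≤ 1 - s x * θ x := fun x hx => by
    have := abs_le.1 (hs1 x hx)
    rcases hθ1 x with h | h <;> rw [h] <;> linarith
  have hid : ∀ φ, TestOn a b φ → ∫ x, φ x * (1 - s x * θ x) ∂ν
      = ∫ x, φ x * (max (cumulLeft ν θ x) (cumul ν θ x) - cumulLeft ν θ x) ∂μ := by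
    intro φ hφ
    obtain ⟨C, hC⟩ := hφ.exists_bound
    have hbm : ∀ {m : Measure ℝ} {f : ℝ → ℝ}, Integrable f m → Integrable (fun x => φ x * f x) m :=
      fun hf => hf.bdd_mul hφ.continuous.aestronglyMeasurable (ae_of_all _ hC)
    have e1 : ∫ x in Ioo a b, u x * (σ x * deriv φ x)
        = ∫ x, (k + cumul ν θ x) * s x * deriv φ x := by
      rw [← hφ.setIntegral_mul_deriv]
      refine integral_congr_ae ?_
      filter_upwards [hk, hl'] with x h1 h2
      rw [h1, h2, mul_assoc]
    have e2 : ∫ x, φ x * upperLim u x ∂μ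
        = ∫ x, φ x * (k + max (cumulLeft ν θ x) (cumul ν θ x)) ∂μ :=
      integral_congr_ae (hμm.mono fun x hx => by simp only [hup x hx])
    have hp := hpair φ hφ
    rw [e1, e2, integral_mul_mul_deriv hθm hθ hφ k l] at hp
    have e3 : ∫ x, φ x * (max (cumulLeft ν θ x) (cumul ν θ x) - cumulLeft ν θ x) ∂μ
        = (∫ x, φ x * (k + max (cumulLeft ν θ x) (cumul ν θ x)) ∂μ)
          - ∫ x, φ x * (k + cumulLeft ν θ x) ∂μ := by
      have i1 : Integrable (fun x => φ x * (k + max (cumulLeft ν θ x) (cumul ν θ x))) μ :=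
        hbm ((integrable_const k).add hmaxi)
      have i2 : Integrable (fun x => φ x * (k + cumulLeft ν θ x)) μ :=
        hbm ((integrable_const k).add hgLi)
      rw [← integral_sub i1 i2]
      congr 1 with x
      ring
    have e4 : ∫ x, φ x * (1 - s x * θ x) ∂ν = (∫ x, φ x ∂ν) - ∫ x, φ x * (s x * θ x) ∂ν := by
      rw [← integral_sub hφ.integrable (hbm hsθ)]
      congr 1 with x
      ring
    rw [e3, e4]
    linarith
  have hAB : ν.withDensity (fun x => ENNReal.ofReal (1 - s x * θ x)) = μ.withDensity
      (fun x => ENNReal.ofReal (max (cumulLeft ν θ x) (cumul ν θ x) - cumulLeft ν θ x)) := by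
    have : IsFiniteMeasure (ν.withDensity fun x => ENNReal.ofReal (1 - s x * θ x)) :=
      isFiniteMeasure_withDensity_ofReal hd1.2
    have : IsFiniteMeasure (μ.withDensity fun x =>
        ENNReal.ofReal (max (cumulLeft ν θ x) (cumul ν θ x) - cumulLeft ν θ x)) :=
      isFiniteMeasure_withDensity_ofReal hd2.2
    refine measure_ext_of_testOn (withDensity_absolutelyContinuous _ _ hν)
      (withDensity_absolutelyContinuous _ _ hμ) fun φ hφ => ?_
    rw [integral_withDensity_eq_integral_toReal_smul hd1m (ae_of_all _ fun _ => by simp),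
      integral_withDensity_eq_integral_toReal_smul hd2m (ae_of_all _ fun _ => by simp)]
    refine Eq.trans ?_ ((hid φ hφ).trans ?_)
    · refine integral_congr_ae (hνm.mono fun x hx => ?_)
      simp only [smul_eq_mul]
      rw [ENNReal.toReal_ofReal (hsθ1 x hx), mul_comm]
    · congr 1 with x
      rw [ENNReal.toReal_ofReal (sub_nonneg.2 (le_max_left _ _)), smul_eq_mul, mul_comm]
  -- On the set where `u` has no upward jump the pairing forces `σ θ = 1`.
  have hnojump : ∀ᵐ x ∂ν, cumul ν θ x ≤ cumulLeft ν θ x → 1 ≤ s x * θ x := by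
    have hNm : MeasurableSet {x | cumul ν θ x ≤ cumulLeft ν θ x} := measurableSet_le hgm hgLm
    have h0 : ∫⁻ x in {x | cumul ν θ x ≤ cumulLeft ν θ x}, ENNReal.ofReal (1 - s x * θ x) ∂ν = 0 := by
      rw [← withDensity_apply _ hNm, hAB, withDensity_apply _ hNm]
      refine (setLIntegral_congr_fun hNm fun x hx => ?_).trans (lintegral_zero (μ := μ.restrict _))
      rw [max_eq_left (show cumul ν θ x ≤ cumulLeft ν θ x from hx), sub_self, ENNReal.ofReal_zero]
    rw [lintegral_eq_zero_iff hd1m] at h0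
    have h0' := (ae_restrict_iff' hNm).1 h0
    filter_upwards [h0'] with x hx hx'
    have := ENNReal.ofReal_eq_zero.1 (hx hx')
    linarith
  -- At an upward jump of `u` the left limit of `σ` equals `1`.
  have hjump : ∀ x ∈ Ioo a b, cumulLeft ν θ x < cumul ν θ x → θ x = 1 ∧ s x + μ.real {x} = 1 := by
    intro x hx hlt
    have hj := cumul_eq_cumulLeft_add hθ x
    have hpos : 0 < ν.real {x} * θ x := by linarith
    have hν0 : 0 ≤ ν.real {x} := measureReal_nonneg
    have hθx : θ x = 1 := by
      rcases hθ1 x with h | h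
      · exact h
      · rw [h] at hpos
        linarith
    refine ⟨hθx, ?_⟩
    have := congrArg (fun m : Measure ℝ => (m {x}).toReal) hAB
    simp only [withDensity_apply _ (measurableSet_singleton x), lintegral_singleton,
      ENNReal.toReal_mul] at this
    rw [ENNReal.toReal_ofReal (hsθ1 x hx),
      ENNReal.toReal_ofReal (sub_nonneg.2 (le_max_left _ _)), max_eq_right hlt.le, hj, hθx] at this
    rw [hθx, mul_one] at hpos
    change (1 - s x * 1) * ν.real {x} = _ * μ.real {x} at this
    have h2 : ν.real {x} * (s x + μ.real {x} - 1) = 0 := by linarith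
    rcases mul_eq_zero.1 h2 with h | h <;> linarith
  -- The turning point.
  set T : Set ℝ := {x | x = a ∨ (x ∈ Ioo a b ∧ s x = 1)} with hT
  have hTb : BddAbove T := ⟨b, by rintro x (rfl | hx); exacts [hab.le, hx.1.2.le]⟩
  have hTa : a ∈ T := Or.inl rfl
  have hlow : ∀ x, a < x → x < sSup T → s x = 1 := by
    intro x hx hxc
    obtain ⟨y, hy, hxy⟩ := exists_lt_of_lt_csSup ⟨a, hTa⟩ hxc
    rcases hy with rfl | hy
    · linarith
    · have h3 := hsanti hxy.le
      rw [hy.2] at h3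
      exact le_antisymm (abs_le.1 (hs1 x ⟨hx, hxy.trans hy.1.2⟩)).2 h3
  have hhigh : ∀ x ∈ Ioo a b, sSup T < x → s x < 1 := by
    intro x hx hxc
    refine lt_of_le_of_ne (abs_le.1 (hs1 x hx)).2 fun h => ?_
    exact absurd (le_csSup hTb (show x ∈ T from Or.inr ⟨hx, h⟩)) (not_le.2 hxc)
  have hca : a ≤ sSup T := le_csSup hTb hTa
  have hcb : sSup T ≤ b := csSup_le ⟨a, hTa⟩ (by rintro x (rfl | hx); exacts [hab.le, hx.1.2.le])
  have hθlow : ∀ᵐ x ∂ν, x ∈ Ioo a (sSup T) → 0 ≤ 1 * θ x := by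
    filter_upwards [hnojump] with x hx hxT
    rcases lt_or_ge (cumulLeft ν θ x) (cumul ν θ x) with h | h
    · rw [(hjump x ⟨hxT.1, hxT.2.trans_le hcb⟩ h).1]
      norm_num
    · have := hx h
      rw [hlow x hxT.1 hxT.2] at this
      linarith
  have hθhigh : ∀ᵐ x ∂ν, x ∈ Ioo (sSup T) b → 0 ≤ (-1) * θ x := by
    filter_upwards [hnojump] with x hx hxT
    have hxI : x ∈ Ioo a b := ⟨hca.trans_lt hxT.1, hxT.2⟩
    rcases lt_or_ge (cumulLeft ν θ x) (cumul ν θ x) with h | h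
    · obtain ⟨y, hy1, hy2⟩ := exists_between hxT.1
      have h3 := hhigh y ⟨hca.trans_lt hy1, hy2.trans hxT.2⟩ hy1
      have h4 := hsjump x y hy2
      linarith [(hjump x hxI h).2]
    · have h5 := hx h
      have h6 := hhigh x hxI hxT.1
      rcases hθ1 x with h7 | h7
      · rw [h7] at h5
        linarith
      · rw [h7]
        norm_num
  refine ⟨sSup T, ⟨hca, hcb⟩, fun x y hx hxy hy => ?_, fun x y hx hxy hy => ?_⟩
  · rw [hup x ⟨hx, (hxy.trans_lt hy).trans_le hcb⟩, hup y ⟨hx.trans_le hxy, hy.trans_le hcb⟩]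
    have := mul_cumul_le_of_ae_nonneg hθ hθlow hx hxy hy
    rw [one_mul, one_mul, one_mul, one_mul] at this
    gcongr
    exacts [this.2, this.1]
  · rw [hup x ⟨hca.trans_lt hx, hxy.trans_lt hy⟩, hup y ⟨(hca.trans_lt hx).trans_le hxy, hy⟩]
    have := mul_cumul_le_of_ae_nonneg hθ hθhigh hx hxy hy
    gcongr
    · linarith [this.2]
    · linarith [this.1]

section Backward

variable {a b : ℝ} {ν : Measure ℝ} [IsFiniteMeasure ν] {θ u : ℝ → ℝ}

/-- The field `l - μ (-∞, x]` pairs with the derivative of `u` to its total variation as soon as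
the defect of the pairing vanishes. -/
lemma pairing_of_defect_eq (hν : ν (Ioo a b)ᶜ = 0) (hθm : Measurable θ)
    (hθ : Integrable θ ν) {k l : ℝ}
    (hk : ∀ᵐ x ∂(volume.restrict (Ioo a b)), u x = k + cumul ν θ x)
    {μ : Measure ℝ} [IsFiniteMeasure μ] (hμ : μ (Ioo a b)ᶜ = 0) {s : ℝ → ℝ}
    (hs : s = fun x => l - cumul μ (fun _ => 1) x) (hs1 : ∀ x ∈ Ioo a b, |s x| ≤ 1)
    {φ : ℝ → ℝ} (hφ : TestOn a b φ) (hid : ∫ x, φ x * (1 - s x * θ x) ∂ν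
      = ∫ x, φ x * (max (cumulLeft ν θ x) (cumul ν θ x) - cumulLeft ν θ x) ∂μ) :
    (∫ x in Ioo a b, s x * deriv φ x = ∫ x, φ x ∂μ) ∧
      (- ∫ x in Ioo a b, u x * (s x * deriv φ x)) + (∫ x, φ x * upperLim u x ∂μ)
        = ∫ x, φ x ∂ν := by
  obtain ⟨C, hC⟩ := hφ.exists_bound
  have hbm : ∀ {m : Measure ℝ} {f : ℝ → ℝ}, Integrable f m → Integrable (fun x => φ x * f x) m :=
    fun hf => hf.bdd_mul hφ.continuous.aestronglyMeasurable (ae_of_all _ hC)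
  have hνm : ∀ᵐ x ∂ν, x ∈ Ioo a b := by
    rw [ae_iff]
    exact hν
  have hμm : ∀ᵐ x ∂μ, x ∈ Ioo a b := by
    rw [ae_iff]
    exact hμ
  have hsm : Measurable s := hs ▸ measurable_const.sub (measurable_cumul measurable_const)
  have hsθ : Integrable (fun x => s x * θ x) ν :=
    hθ.bdd_mul hsm.aestronglyMeasurable (hνm.mono fun x hx => hs1 x hx)
  have hgLi : Integrable (cumulLeft ν θ) μ :=
    Integrable.of_bound (measurable_cumulLeft hθm).aestronglyMeasurable _
      (ae_of_all _ (norm_cumulLeft_le hθ))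
  have hgi : Integrable (cumul ν θ) μ :=
    Integrable.of_bound (measurable_cumul hθm).aestronglyMeasurable _
      (ae_of_all _ (norm_cumul_le hθ))
  have i1 : Integrable (fun x => φ x * (k + max (cumulLeft ν θ x) (cumul ν θ x))) μ :=
    hbm ((integrable_const k).add (hgLi.sup hgi))
  have i2 : Integrable (fun x => φ x * (k + cumulLeft ν θ x)) μ :=
    hbm ((integrable_const k).add hgLi)
  constructor
  · have := integral_mul_mul_deriv (ν := 0) (μ := μ) (θ := θ) hθm (integrable_zero_measure) hφ 1 l
    simp only [cumul, cumulLeft, Measure.restrict_zero, integral_zero_measure, add_zero, mul_one,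
      one_mul, sub_zero] at this
    rw [hφ.setIntegral_mul_deriv, hs, ← this]
    simp only [cumul]
  · have e1 : ∫ x in Ioo a b, u x * (s x * deriv φ x)
        = ∫ x, (k + cumul ν θ x) * s x * deriv φ x := by
      rw [← hφ.setIntegral_mul_deriv]
      refine integral_congr_ae ?_
      filter_upwards [hk] with x h1
      rw [h1, mul_assoc]
    have e2 : ∫ x, φ x * upperLim u x ∂μ
        = ∫ x, φ x * (k + max (cumulLeft ν θ x) (cumul ν θ x)) ∂μ :=
      integral_congr_ae (hμm.mono fun x hx => by
        simp only [upperLim_eq_const_add_max hθ hk hx])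
    have e3 : ∫ x, φ x * (max (cumulLeft ν θ x) (cumul ν θ x) - cumulLeft ν θ x) ∂μ
        = (∫ x, φ x * (k + max (cumulLeft ν θ x) (cumul ν θ x)) ∂μ)
          - ∫ x, φ x * (k + cumulLeft ν θ x) ∂μ := by
      rw [← integral_sub i1 i2]
      congr 1 with x
      ring
    have e4 : ∫ x, φ x * (1 - s x * θ x) ∂ν = (∫ x, φ x ∂ν) - ∫ x, φ x * (s x * θ x) ∂ν := by
      rw [← integral_sub hφ.integrable (hbm hsθ)]
      congr 1 with x
      ring
    have e5 := integral_mul_mul_deriv (μ := μ) hθm hθ hφ k l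
    rw [e1, e2]
    simp only [hs] at e4 hid ⊢
    rw [e5]
    rw [e3, e4] at hid
    linarith

/-- A unimodal function admits a non-increasing field `σ` with `|σ| ≤ 1` pairing with its
derivative to its total variation. -/
lemma exists_pairing_of_unimodalOn (hab : a < b) (hν : ν (Ioo a b)ᶜ = 0) (hθm : Measurable θ)
    (hθ1 : ∀ x, θ x = 1 ∨ θ x = -1) (hu : IntegrableOn u (Ioo a b))
    (hgrad : ∀ φ, TestOn a b φ → ∫ x in Ioo a b, u x * deriv φ x = - ∫ x, φ x * θ x ∂ν)
    (h : UnimodalOn a b (upperLim u)) :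
    ∃ (σ : ℝ → ℝ) (μ : Measure ℝ), Measurable σ ∧ (∀ x ∈ Ioo a b, |σ x| ≤ 1) ∧
      IsFiniteMeasure μ ∧ μ (Ioo a b)ᶜ = 0 ∧ ∀ φ, TestOn a b φ →
        (∫ x in Ioo a b, σ x * deriv φ x = ∫ x, φ x ∂μ) ∧
        (- ∫ x in Ioo a b, u x * (σ x * deriv φ x)) + (∫ x, φ x * upperLim u x ∂μ)
          = ∫ x, φ x ∂ν := by
  obtain ⟨c, ⟨hac, hcb⟩, hup, hdown⟩ := h
  have hθ : Integrable θ ν := integrable_of_sign hθm hθ1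
  obtain ⟨k, hk⟩ := exists_ae_eq_const_add_cumul hab hθm hθ hu hgrad
  have hval : ∀ x ∈ Ioo a b, upperLim u x = k + max (cumulLeft ν θ x) (cumul ν θ x) :=
    fun x hx => upperLim_eq_const_add_max hθ hk hx
  have hpos : ∀ᵐ t ∂ν, t ∈ Ioo a c → θ t = 1 := by
    have := ae_nonneg_of_mul_max_cumul_le (p := a) (q := c) (ε := 1) hθ fun x y hx hxy hy => by
      have := hup x y hx hxy hy
      rw [hval x ⟨hx, (hxy.trans_lt hy).trans_le hcb⟩,
        hval y ⟨hx.trans_le hxy, hy.trans_le hcb⟩] at this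
      linarith
    filter_upwards [this] with t ht htI
    rcases hθ1 t with h | h
    · exact h
    · have := ht htI
      rw [h] at this
      norm_num at this
  have hneg : ∀ᵐ t ∂ν, t ∈ Ioo c b → θ t = -1 := by
    have := ae_nonneg_of_mul_max_cumul_le (p := c) (q := b) (ε := -1) hθ fun x y hx hxy hy => by
      have := hdown x y hx hxy hy
      rw [hval x ⟨hac.trans_lt hx, hxy.trans_lt hy⟩,
        hval y ⟨(hac.trans_lt hx).trans_le hxy, hy⟩] at this
      linarith
    filter_upwards [this] with t ht htI
    rcases hθ1 t with h | h
    · have := ht htI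
      rw [h] at this
      norm_num at this
    · exact h
  have hνm : ∀ᵐ x ∂ν, x ∈ Ioo a b := by
    rw [ae_iff]
    exact hν
  have hconst : ∀ l : ℝ, |l| ≤ 1 → (∀ᵐ t ∂ν, l * θ t = 1) →
      ∃ (σ : ℝ → ℝ) (μ : Measure ℝ), Measurable σ ∧ (∀ x ∈ Ioo a b, |σ x| ≤ 1) ∧
      IsFiniteMeasure μ ∧ μ (Ioo a b)ᶜ = 0 ∧ ∀ φ, TestOn a b φ →
        (∫ x in Ioo a b, σ x * deriv φ x = ∫ x, φ x ∂μ) ∧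
        (- ∫ x in Ioo a b, u x * (σ x * deriv φ x)) + (∫ x, φ x * upperLim u x ∂μ)
          = ∫ x, φ x ∂ν := by
    intro l hl hlθ
    have hs : (fun _ : ℝ => l) = fun x => l - cumul 0 (fun _ => 1) x := by simp [cumul]
    refine ⟨fun _ => l, 0, measurable_const, fun _ _ => hl, inferInstance, by simp, fun φ hφ =>
      pairing_of_defect_eq hν hθm hθ hk (by simp) hs (fun _ _ => hl) hφ ?_⟩
    rw [integral_zero_measure]
    refine integral_eq_zero_of_ae ?_
    filter_upwards [hlθ] with t ht
    simp [ht]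
  rcases hac.eq_or_lt with rfl | hac
  · refine hconst (-1) (by norm_num) ?_
    filter_upwards [hneg, hνm] with t ht htI
    rw [ht htI]
    norm_num
  rcases hcb.eq_or_lt with rfl | hcb
  · refine hconst 1 (by norm_num) ?_
    filter_upwards [hpos, hνm] with t ht htI
    rw [ht htI]
    norm_num
  set μ : Measure ℝ := (2 : ℝ≥0∞) • Measure.dirac c with hμd
  have : IsFiniteMeasure μ := Measure.smul_finite _ (by simp)
  have hμ : μ (Ioo a b)ᶜ = 0 := by
    simp [hμd, hac, hcb]
  set s : ℝ → ℝ := fun x => 1 - cumul μ (fun _ => 1) x with hs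
  have hsl : ∀ x, x < c → s x = 1 := fun x hx => by
    simp [hs, cumul, hμd, Measure.real, hx]
  have hsr : ∀ x, c ≤ x → s x = -1 := fun x hx => by
    simp [hs, cumul, hμd, Measure.real, hx]
    norm_num
  have hs1 : ∀ x, |s x| ≤ 1 := fun x => by
    rcases lt_or_ge x c with h | h
    · simp [hsl x h]
    · simp [hsr x h]
  refine ⟨s, μ, measurable_const.sub (measurable_cumul measurable_const), fun x _ => hs1 x, this,
    hμ, fun φ hφ => pairing_of_defect_eq hν hθm hθ hk hμ hs (fun x _ => hs1 x) hφ ?_⟩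
  have e1 : ∫ x, φ x * (1 - s x * θ x) ∂ν
      = ∫ x, ({c} : Set ℝ).indicator (fun x => φ x * (1 + θ x)) x ∂ν := by
    refine integral_congr_ae ?_
    filter_upwards [hpos, hneg, hνm] with t h1 h2 h3
    rcases lt_trichotomy t c with h | rfl | h
    · rw [indicator_of_notMem (by simpa using h.ne), h1 ⟨h3.1, h⟩, hsl t h]
      ring
    · rw [indicator_of_mem (mem_singleton t), hsr t le_rfl]
      ring
    · rw [indicator_of_notMem (by simpa using h.ne'), h2 ⟨h, h3.2⟩, hsr t h.le]
      ring
  rw [e1, integral_indicator (measurableSet_singleton c), integral_singleton, hμd,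
    integral_smul_measure, integral_dirac, cumul_eq_cumulLeft_add hθ c]
  have hν0 : 0 ≤ ν.real {c} := measureReal_nonneg
  rcases hθ1 c with h | h
  · rw [h, max_eq_right (by linarith)]
    simp
    ring
  · rw [h, max_eq_left (by linarith)]
    simp

end Backward

section Polar

variable {a b : ℝ} {ν : Measure ℝ} {θ u : ℝ → ℝ}

lemma aestronglyMeasurable_of_forall_testOn_mul (hν : ν (Ioo a b)ᶜ = 0)
    (h : ∀ φ, TestOn a b φ → AEStronglyMeasurable (fun x => φ x * θ x) ν) :
    AEStronglyMeasurable θ ν := by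
  have hbump : ∀ x ∈ Ioo a b, ∃ φ, TestOn a b φ ∧ φ x = 1 := fun x hx => by
    obtain ⟨f, h1, h2, h3, -, h5⟩ :=
      exists_contDiff_tsupport_subset (n := ⊤) (isOpen_Ioo.mem_nhds hx)
    exact ⟨f, ⟨h3, h2, h1⟩, h5⟩
  choose! f hf hf1 using hbump
  obtain ⟨t, htI, htc, ht⟩ := TopologicalSpace.countable_cover_nhdsWithin (s := Ioo a b)
    (f := fun x => {y | f x y ≠ 0}) fun x hx => mem_nhdsWithin_of_mem_nhds
      ((hf x hx).continuous.continuousAt.eventually_ne (by rw [hf1 x hx]; exact one_ne_zero))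
  have : Countable t := htc.to_subtype
  have hU : ν.restrict (⋃ x : t, {y | f x y ≠ 0}) = ν := by
    refine Measure.restrict_eq_self_of_ae_mem ?_
    have : ∀ᵐ x ∂ν, x ∈ Ioo a b := by
      rw [ae_iff]
      exact hν
    filter_upwards [this] with x hx
    have := ht hx
    rwa [biUnion_eq_iUnion] at this
  rw [← hU, aestronglyMeasurable_iUnion_iff]
  rintro ⟨x, hx⟩
  have hc := (hf x (htI hx)).continuous
  have hm : MeasurableSet {y | f x y ≠ 0} := (isOpen_ne_fun hc continuous_const).measurableSet
  have hi : AEStronglyMeasurable (fun y => (f x y)⁻¹ * (f x y * θ y)) ν :=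
    hc.measurable.inv.aestronglyMeasurable.mul (h _ (hf x (htI hx)))
  refine hi.restrict.congr ?_
  filter_upwards [ae_restrict_mem hm] with y hy
  exact inv_mul_cancel_left₀ hy _

/-- The polar density of a derivative measure can be chosen measurable, unless the derivative
vanishes. -/
lemma exists_measurable_sign_or_integral_eq_zero (hν : ν (Ioo a b)ᶜ = 0)
    (hθ1 : ∀ᵐ x ∂ν, |θ x| = 1) (hu : IntegrableOn u (Ioo a b))
    (hgrad : ∀ φ, TestOn a b φ → ∫ x in Ioo a b, u x * deriv φ x = - ∫ x, φ x * θ x ∂ν) :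
    (∃ θ' : ℝ → ℝ, Measurable θ' ∧ (∀ x, θ' x = 1 ∨ θ' x = -1) ∧ θ =ᵐ[ν] θ') ∨
      ∀ φ, TestOn a b φ → ∫ x in Ioo a b, u x * deriv φ x = 0 := by
  by_cases hm : AEStronglyMeasurable θ ν
  · left
    refine ⟨fun x => if 0 ≤ hm.mk θ x then 1 else -1, Measurable.ite
      (measurableSet_le measurable_const hm.stronglyMeasurable_mk.measurable) measurable_const
      measurable_const, fun x => ?_, ?_⟩
    · by_cases h : 0 ≤ hm.mk θ x <;> simp [h]
    · filter_upwards [hm.ae_eq_mk, hθ1] with x h1 h2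
      rw [← h1]
      rcases eq_or_eq_neg_of_abs_eq h2 with h | h <;> rw [h] <;> norm_num
  · right
    obtain ⟨φ₀, hφ₀, hn⟩ : ∃ φ, TestOn a b φ ∧ ¬ AEStronglyMeasurable (fun x => φ x * θ x) ν := by
      by_contra! hcon
      exact hm (aestronglyMeasurable_of_forall_testOn_mul hν hcon)
    have hzero : ∀ φ, TestOn a b φ → ¬ AEStronglyMeasurable (fun x => φ x * θ x) ν →
        ∫ x in Ioo a b, u x * deriv φ x = 0 := fun φ hφ h => by
      rw [hgrad φ hφ, integral_undef fun h' => h h'.1, neg_zero]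
    intro ψ hψ
    by_cases hψm : AEStronglyMeasurable (fun x => ψ x * θ x) ν
    · have h1 := hzero _ (hφ₀.add hψ) fun h => hn <| (h.sub hψm).congr <| ae_of_all _ fun x => by
        simp only [Pi.sub_apply]
        ring
      have e : ∀ x, u x * deriv (fun x => φ₀ x + ψ x) x = u x * deriv φ₀ x + u x * deriv ψ x :=
        fun x => by
          rw [deriv_fun_add (hφ₀.hasDerivAt x).differentiableAt (hψ.hasDerivAt x).differentiableAt,
            mul_add]
      simp only [e] at h1
      rw [integral_add (hφ₀.integrableOn_mul_deriv hu) (hψ.integrableOn_mul_deriv hu),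
        hzero φ₀ hφ₀ hn, zero_add] at h1
      exact h1
    · exact hzero ψ hψ hψm

end Polar

lemma unimodalOn_of_forall_Ioo {a b : ℝ} (hab : a ≤ b) {f : ℝ → ℝ}
    (h : ∀ p q, a < p → p < q → q < b → UnimodalOn p q f) : UnimodalOn a b f := by
  set T : Set ℝ := {z | z = a ∨ (z ∈ Ioo a b ∧ ∀ x y, a < x → x ≤ y → y < z → f x ≤ f y)} with hT
  have hTb : b ∈ upperBounds T := by
    rintro z (rfl | hz)
    exacts [hab, hz.1.2.le]
  have hTa : a ∈ T := Or.inl rfl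
  have hca : a ≤ sSup T := le_csSup ⟨b, hTb⟩ hTa
  refine ⟨sSup T, ⟨hca, csSup_le ⟨a, hTa⟩ hTb⟩, fun x y hx hxy hy => ?_, fun x y hx hxy hy => ?_⟩
  · obtain ⟨z, hz, hyz⟩ := exists_lt_of_lt_csSup ⟨a, hTa⟩ hy
    rcases hz with rfl | hz
    · linarith
    · exact hz.2 x y hx hxy hyz
  · obtain ⟨z, hcz, hzx⟩ := exists_between hx
    have hz : ∃ x₀ y₀, a < x₀ ∧ x₀ ≤ y₀ ∧ y₀ < z ∧ f y₀ < f x₀ := by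
      by_contra! hcon
      refine absurd (le_csSup ⟨b, hTb⟩ (show z ∈ T from Or.inr ⟨⟨hca.trans_lt hcz, ?_⟩, ?_⟩))
        (not_le.2 hcz)
      · linarith
      · exact hcon
    obtain ⟨x₀, y₀, hx₀, hxy₀, hy₀, hlt⟩ := hz
    obtain ⟨p, hap, hpx⟩ := exists_between hx₀
    obtain ⟨q, hyq, hqb⟩ := exists_between hy
    obtain ⟨c, -, hup, hdown⟩ := h p q hap (by linarith) hqb
    have hc : c ≤ y₀ := by
      by_contra! hcon
      exact absurd (hup x₀ y₀ hpx hxy₀ hcon) (not_le.2 hlt)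
    exact hdown x y (by linarith) hxy hyq

lemma unimodalOn_upperLim_of_ae_eq_const {a b k : ℝ} (hab : a ≤ b) {u : ℝ → ℝ}
    (hk : ∀ᵐ x ∂(volume.restrict (Ioo a b)), u x = k) : UnimodalOn a b (upperLim u) := by
  have hval : ∀ x ∈ Ioo a b, upperLim u x = k := fun x hx => by
    rw [upperLim_eq_max (v := fun _ => k) hk hx tendsto_const_nhds tendsto_const_nhds, max_self]
  refine ⟨a, left_mem_Icc.2 hab, fun x y hx hxy hy => ?_, fun x y hx hxy hy => ?_⟩
  · linarith
  · rw [hval x ⟨hx, by linarith⟩, hval y ⟨by linarith, hy⟩]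

/-- The local version of `unimodalOn_of_pairing`: the measures need only be finite on compact
subsets, and no measurability of the polar density is required. -/
lemma unimodalOn_of_pairing_of_locallyFinite {a b : ℝ} (hab : a < b) {ν μ : Measure ℝ}
    (hνK : ∀ K ⊆ Ioo a b, IsCompact K → ν K < ⊤) (hμK : ∀ K ⊆ Ioo a b, IsCompact K → μ K < ⊤)
    (hν : ν (Ioo a b)ᶜ = 0) {θ u σ : ℝ → ℝ} (hθ1 : ∀ᵐ x ∂ν, |θ x| = 1)
    (hu : IntegrableOn u (Ioo a b)) (hσ : IntegrableOn σ (Ioo a b))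
    (hσ1 : ∀ᵐ x ∂(volume.restrict (Ioo a b)), |σ x| ≤ 1)
    (hgrad : ∀ φ, TestOn a b φ → ∫ x in Ioo a b, u x * deriv φ x = - ∫ x, φ x * θ x ∂ν)
    (hdiv : ∀ φ, TestOn a b φ → ∫ x in Ioo a b, σ x * deriv φ x = ∫ x, φ x ∂μ)
    (hpair : ∀ φ, TestOn a b φ → (- ∫ x in Ioo a b, u x * (σ x * deriv φ x))
      + (∫ x, φ x * upperLim u x ∂μ) = ∫ x, φ x ∂ν) :
    UnimodalOn a b (upperLim u) := by
  rcases exists_measurable_sign_or_integral_eq_zero hν hθ1 hu hgrad with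
    ⟨θ', hθm, hθ', hθe⟩ | h0
  · refine unimodalOn_of_forall_Ioo hab.le fun p q hp hpq hq => ?_
    have hsub : Ioo p q ⊆ Ioo a b := Ioo_subset_Ioo hp.le hq.le
    have hsubc : Icc p q ⊆ Ioo a b := Icc_subset_Ioo hp hq
    have : IsFiniteMeasure (ν.restrict (Ioo p q)) := isFiniteMeasure_restrict.2
      ((measure_mono Ioo_subset_Icc_self).trans_lt (hνK _ hsubc isCompact_Icc)).ne
    have : IsFiniteMeasure (μ.restrict (Ioo p q)) := isFiniteMeasure_restrict.2
      ((measure_mono Ioo_subset_Icc_self).trans_lt (hμK _ hsubc isCompact_Icc)).ne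
    have hvol : ∀ {φ : ℝ → ℝ} (f : ℝ → ℝ), TestOn p q φ →
        ∫ x in Ioo p q, f x * deriv φ x = ∫ x in Ioo a b, f x * deriv φ x := fun f hφ => by
      rw [hφ.setIntegral_mul_deriv, (hφ.mono hp.le hq.le).setIntegral_mul_deriv]
    have hmeas : ∀ {φ : ℝ → ℝ} (m : Measure ℝ) (f : ℝ → ℝ), TestOn p q φ →
        ∫ x in Ioo p q, φ x * f x ∂m = ∫ x, φ x * f x ∂m := fun m f hφ =>
      setIntegral_eq_integral_of_forall_compl_eq_zero fun x hx => by
        rw [hφ.eq_zero hx, zero_mul]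
    have hmeas1 : ∀ {φ : ℝ → ℝ} (m : Measure ℝ), TestOn p q φ →
        ∫ x in Ioo p q, φ x ∂m = ∫ x, φ x ∂m := fun m hφ =>
      setIntegral_eq_integral_of_forall_compl_eq_zero fun x hx => hφ.eq_zero hx
    refine unimodalOn_of_pairing hpq (ν := ν.restrict (Ioo p q)) (μ := μ.restrict (Ioo p q))
      (θ := θ') (σ := σ) ?_ ?_ hθm hθ' (hu.mono_set hsub) (hσ.mono_set hsub)
      (ae_restrict_of_ae_restrict_of_subset hsub hσ1) (fun φ hφ => ?_) (fun φ hφ => ?_)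
      fun φ hφ => ?_
    · rw [Measure.restrict_apply measurableSet_Ioo.compl, compl_inter_self, measure_empty]
    · rw [Measure.restrict_apply measurableSet_Ioo.compl, compl_inter_self, measure_empty]
    · rw [hvol u hφ, hmeas ν θ' hφ, hgrad φ (hφ.mono hp.le hq.le)]
      congr 1
      exact integral_congr_ae (hθe.mono fun x hx => by simp only [hx])
    · rw [hvol σ hφ, hmeas1 μ hφ, hdiv φ (hφ.mono hp.le hq.le)]
    · rw [hmeas μ _ hφ, hmeas1 ν hφ, ← hpair φ (hφ.mono hp.le hq.le)]
      congr 2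
      simpa only [mul_assoc] using hvol (fun x => u x * σ x) hφ
  · obtain ⟨k, hk⟩ := exists_ae_eq_const_of_integral_mul_deriv_eq_zero hab hu h0
    exact unimodalOn_upperLim_of_ae_eq_const hab.le hk

/-- The isometric identification of the line with one-dimensional Euclidean space. -/
def lineEquiv : ℝ ≃ₗᵢ[ℝ] Eu 1 := (OrthonormalBasis.singleton (Fin 1) ℝ).repr

section Line

variable {a b : ℝ}

@[simp]
lemma lineEquiv_apply_zero (t : ℝ) : lineEquiv t 0 = t :=
  OrthonormalBasis.singleton_repr t 0

@[simp]
lemma lineEquiv_coord (x : Eu 1) : lineEquiv (x 0) = x := by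
  ext i
  rw [Subsingleton.elim i 0, lineEquiv_apply_zero]

lemma lineEquiv_symm_apply (x : Eu 1) : lineEquiv.symm x = x 0 := by
  rw [LinearIsometryEquiv.symm_apply_eq, lineEquiv_coord]

lemma norm_eq_abs_coord (x : Eu 1) : ‖x‖ = |x 0| := by
  simp [EuclideanSpace.norm_eq, Real.sqrt_sq_eq_abs]

lemma inner_eq_mul_coord (x y : Eu 1) : ⟪x, y⟫ = x 0 * y 0 := by
  simp [PiLp.inner_apply, mul_comm]

lemma measurableEmbedding_lineEquiv : MeasurableEmbedding lineEquiv :=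
  lineEquiv.toMeasurableEquiv.measurableEmbedding

lemma measurePreserving_lineEquiv : MeasurePreserving lineEquiv volume volume :=
  lineEquiv.measurePreserving

lemma lineEquiv_preimage_strip : lineEquiv ⁻¹' {x : Eu 1 | a < x 0 ∧ x 0 < b} = Ioo a b := by
  ext t
  simp

lemma map_lineEquiv_restrict_Ioo :
    (volume.restrict (Ioo a b)).map lineEquiv
      = volume.restrict {x : Eu 1 | a < x 0 ∧ x 0 < b} := by
  rw [← lineEquiv_preimage_strip, ← measurableEmbedding_lineEquiv.restrict_map,
    measurePreserving_lineEquiv.map_eq]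

lemma exists_eq_map_lineEquiv (m : Measure (Eu 1)) :
    ∃ m' : Measure ℝ, m'.map lineEquiv = m :=
  ⟨m.map lineEquiv.toMeasurableEquiv.symm, lineEquiv.toMeasurableEquiv.map_map_symm⟩

lemma integral_map_lineEquiv {E : Type*} [NormedAddCommGroup E] [NormedSpace ℝ E]
    (m : Measure ℝ) (f : Eu 1 → E) :
    ∫ x, f x ∂(m.map lineEquiv) = ∫ t, f (lineEquiv t) ∂m :=
  measurableEmbedding_lineEquiv.integral_map f

lemma setIntegral_strip {E : Type*} [NormedAddCommGroup E] [NormedSpace ℝ E] (f : Eu 1 → E) :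
    ∫ x in {x : Eu 1 | a < x 0 ∧ x 0 < b}, f x = ∫ t in Ioo a b, f (lineEquiv t) := by
  rw [← map_lineEquiv_restrict_Ioo, integral_map_lineEquiv]

lemma integral_coord {X : Type*} [MeasurableSpace X] (m : Measure X) (f : X → Eu 1) :
    (∫ x, f x ∂m) 0 = ∫ x, f x 0 ∂m := by
  have := lineEquiv.symm.toContinuousLinearEquiv.integral_comp_comm (μ := m) f
  simpa [lineEquiv_symm_apply] using this.symm

lemma gradient_lineEquiv {φ : Eu 1 → ℝ} (hφ : Differentiable ℝ φ) (t : ℝ) :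
    gradient φ (lineEquiv t) 0 = deriv (fun t => φ (lineEquiv t)) t := by
  have h1 : HasDerivAt (fun t => φ (lineEquiv t)) (fderiv ℝ φ (lineEquiv t) (lineEquiv 1)) t := by
    have h2 : HasDerivAt (fun t => lineEquiv t) (lineEquiv 1) t :=
      lineEquiv.toContinuousLinearEquiv.toContinuousLinearMap.hasDerivAt
    exact (hφ _).hasFDerivAt.comp_hasDerivAt t h2
  rw [h1.deriv, ← InnerProductSpace.toDual_symm_apply, inner_eq_mul_coord, lineEquiv_apply_zero,
    mul_one]
  rfl

lemma isTest_iff_testOn {φ : Eu 1 → ℝ} :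
    IsTest {x : Eu 1 | a < x 0 ∧ x 0 < b} φ ↔ TestOn a b (fun t => φ (lineEquiv t)) := by
  have ht : tsupport (fun t => φ (lineEquiv t)) = lineEquiv ⁻¹' tsupport φ :=
    tsupport_comp_eq_preimage φ lineEquiv.toHomeomorph
  refine and_congr ?_ (and_congr ?_ ?_)
  · exact (lineEquiv.toContinuousLinearEquiv.contDiff_comp_iff (f := φ)).symm
  · refine ⟨fun h => h.comp_homeomorph lineEquiv.toHomeomorph, fun h => ?_⟩
    have := h.comp_homeomorph lineEquiv.symm.toHomeomorph
    simpa [Function.comp_def] using this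
  · rw [ht, ← lineEquiv_preimage_strip, lineEquiv.surjective.preimage_subset_preimage_iff]

lemma TestOn.isTest {ψ : ℝ → ℝ} (h : TestOn a b ψ) :
    IsTest {x : Eu 1 | a < x 0 ∧ x 0 < b} (fun x => ψ (x 0)) := by
  simpa [isTest_iff_testOn] using h

lemma upperRep_lineEquiv (u : Eu 1 → ℝ) (t : ℝ) :
    upperRep u (lineEquiv t) = upperLim (fun t => u (lineEquiv t)) t := by
  have hv : ∀ A : Set (Eu 1), volume A = volume (lineEquiv ⁻¹' A) := fun A =>
    (measurePreserving_lineEquiv.measure_preimage_emb measurableEmbedding_lineEquiv A).symm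
  simp only [upperRep, upperLim, DensityZeroAt]
  congr 1
  ext r
  simp only [hv (_ ∩ _), hv (ball _ _), preimage_inter, lineEquiv.preimage_ball,
    LinearIsometryEquiv.symm_apply_apply]
  rfl

lemma locFinOn_map_iff {m : Measure ℝ} :
    LocFinOn {x : Eu 1 | a < x 0 ∧ x 0 < b} (m.map lineEquiv) ↔
      (∀ K ⊆ Ioo a b, IsCompact K → m K < ⊤) ∧ m (Ioo a b)ᶜ = 0 := by
  simp only [LocFinOn, measurableEmbedding_lineEquiv.map_apply, preimage_compl,
    lineEquiv_preimage_strip]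
  refine and_congr_left fun _ => ⟨fun h K hK hKc => ?_, fun h K hK hKc => ?_⟩
  · have := h (lineEquiv '' K) (image_subset_iff.2 (lineEquiv_preimage_strip.symm ▸ hK))
      (hKc.image lineEquiv.continuous)
    rwa [lineEquiv.injective.preimage_image] at this
  · refine h _ (lineEquiv_preimage_strip ▸ preimage_mono hK) ?_
    exact (lineEquiv.toHomeomorph.isCompact_preimage).2 hKc

lemma setIntegral_smul_gradient {u φ : Eu 1 → ℝ} (hφ : IsTest {x : Eu 1 | a < x 0 ∧ x 0 < b} φ) :
    (∫ x in {x : Eu 1 | a < x 0 ∧ x 0 < b}, u x • gradient φ x) 0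
      = ∫ t in Ioo a b, u (lineEquiv t) * deriv (fun t => φ (lineEquiv t)) t := by
  rw [setIntegral_strip, integral_coord]
  simp [gradient_lineEquiv (hφ.1.differentiable (by simp))]

lemma setIntegral_inner_gradient {σ : Eu 1 → Eu 1} {φ : Eu 1 → ℝ}
    (hφ : IsTest {x : Eu 1 | a < x 0 ∧ x 0 < b} φ) :
    ∫ x in {x : Eu 1 | a < x 0 ∧ x 0 < b}, ⟪σ x, gradient φ x⟫
      = ∫ t in Ioo a b, σ (lineEquiv t) 0 * deriv (fun t => φ (lineEquiv t)) t := by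
  simp only [setIntegral_strip, inner_eq_mul_coord,
    gradient_lineEquiv (hφ.1.differentiable (by simp))]

lemma setIntegral_mul_inner_gradient {u : Eu 1 → ℝ} {σ : Eu 1 → Eu 1} {φ : Eu 1 → ℝ}
    (hφ : IsTest {x : Eu 1 | a < x 0 ∧ x 0 < b} φ) :
    ∫ x in {x : Eu 1 | a < x 0 ∧ x 0 < b}, u x * ⟪σ x, gradient φ x⟫
      = ∫ t in Ioo a b,
        u (lineEquiv t) * (σ (lineEquiv t) 0 * deriv (fun t => φ (lineEquiv t)) t) := by
  simp only [setIntegral_strip, inner_eq_mul_coord,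
    gradient_lineEquiv (hφ.1.differentiable (by simp))]

lemma hasGradMeasure_map_iff {u : Eu 1 → ℝ} {m : Measure ℝ} {θ : Eu 1 → Eu 1} :
    HasGradMeasure {x : Eu 1 | a < x 0 ∧ x 0 < b} u (m.map lineEquiv) θ ↔
      (∀ᵐ t ∂m, |θ (lineEquiv t) 0| = 1) ∧ m (Ioo a b)ᶜ = 0 ∧ ∀ φ, TestOn a b φ →
        ∫ t in Ioo a b, u (lineEquiv t) * deriv φ t = - ∫ t, φ t * θ (lineEquiv t) 0 ∂m := by
  have hinteg : ∀ φ : Eu 1 → ℝ, IsTest {x : Eu 1 | a < x 0 ∧ x 0 < b} φ →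
      ((∫ x in {x : Eu 1 | a < x 0 ∧ x 0 < b}, u x • gradient φ x
        = - ∫ x, φ x • θ x ∂(m.map lineEquiv)) ↔
      ∫ t in Ioo a b, u (lineEquiv t) * deriv (fun t => φ (lineEquiv t)) t
        = - ∫ t, φ (lineEquiv t) * θ (lineEquiv t) 0 ∂m) := fun φ hφ => by
    rw [← lineEquiv.symm.injective.eq_iff, lineEquiv_symm_apply, lineEquiv_symm_apply,
      setIntegral_smul_gradient hφ, PiLp.neg_apply, integral_map_lineEquiv, integral_coord]
    simp
  refine and_congr ?_ (and_congr ?_ ?_)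
  · rw [measurableEmbedding_lineEquiv.ae_map_iff]
    simp only [norm_eq_abs_coord]
  · rw [measurableEmbedding_lineEquiv.map_apply, preimage_compl, lineEquiv_preimage_strip]
  · refine ⟨fun h φ hφ => ?_, fun h φ hφ => (hinteg φ hφ).2 (h _ (isTest_iff_testOn.1 hφ))⟩
    simpa using (hinteg _ hφ.isTest).1 (h _ hφ.isTest)

end Line

/-- one-dimensional characterization: on a bounded interval
`(a,b) ⊂ ℝ`, a function `u ∈ BV(a,b) ∩ L^∞(a,b)` is weakly super-1-harmonic iff there
is `c ∈ [a,b]` such that `u⁺` is non-decreasing on `(a,c)` and non-increasing on `(c,b)`. -/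
theorem stmt13 (a b : ℝ) (hab : a < b) (u : Eu 1 → ℝ)
    (hu1 : IntegrableOn u {x : Eu 1 | a < x 0 ∧ x 0 < b})
    (hub : ∃ C, BddFun {x : Eu 1 | a < x 0 ∧ x 0 < b} u C)
    (ν : Measure (Eu 1)) (θ : Eu 1 → Eu 1)
    (hν : FinOn {x : Eu 1 | a < x 0 ∧ x 0 < b} ν)
    (hgrad : HasGradMeasure {x : Eu 1 | a < x 0 ∧ x 0 < b} u ν θ) :
    SuperOneHarmonic {x : Eu 1 | a < x 0 ∧ x 0 < b} u ↔
      ∃ c : ℝ, c ∈ Icc a b ∧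
        (∀ x y : Eu 1, a < x 0 → x 0 ≤ y 0 → y 0 < c → upperRep u x ≤ upperRep u y) ∧
        (∀ x y : Eu 1, c < x 0 → x 0 ≤ y 0 → y 0 < b → upperRep u y ≤ upperRep u x) := by
  obtain ⟨m, rfl⟩ := exists_eq_map_lineEquiv ν
  have hui : IntegrableOn (fun t => u (lineEquiv t)) (Ioo a b) := by
    rw [IntegrableOn, ← map_lineEquiv_restrict_Ioo] at hu1
    exact measurableEmbedding_lineEquiv.integrable_map_iff.1 hu1
  have hmain : SuperOneHarmonic {x : Eu 1 | a < x 0 ∧ x 0 < b} u ↔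
      UnimodalOn a b (upperLim fun t => u (lineEquiv t)) := by
    constructor
    · rintro ⟨-, -, σ, μ, hσ, -, hdiv, hμ, ν', θ', hν', hgrad', hpair⟩
      obtain ⟨n, rfl⟩ := exists_eq_map_lineEquiv ν'
      obtain ⟨k, rfl⟩ := exists_eq_map_lineEquiv μ
      rw [locFinOn_map_iff] at hν' hμ
      rw [hasGradMeasure_map_iff] at hgrad'
      rw [Bdd, ← map_lineEquiv_restrict_Ioo, measurableEmbedding_lineEquiv.ae_map_iff,
        measurableEmbedding_lineEquiv.aestronglyMeasurable_map_iff] at hσ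
      simp only [norm_eq_abs_coord] at hσ
      have hσm : AEStronglyMeasurable (fun t => σ (lineEquiv t) 0) (volume.restrict (Ioo a b)) := by
        have := lineEquiv.symm.continuous.comp_aestronglyMeasurable hσ.1
        simpa only [lineEquiv_symm_apply, Function.comp_apply] using this
      refine unimodalOn_of_pairing_of_locallyFinite hab hν'.1 hμ.1 hν'.2 hgrad'.1 hui
        (Integrable.of_bound hσm 1 hσ.2) hσ.2 hgrad'.2.2 (fun φ hφ => ?_) fun φ hφ => ?_
      · have := hdiv _ hφ.isTest
        rw [setIntegral_inner_gradient hφ.isTest, integral_map_lineEquiv] at this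
        simpa using this
      · have := hpair _ hφ.isTest
        rw [setIntegral_mul_inner_gradient hφ.isTest, integral_map_lineEquiv,
          integral_map_lineEquiv] at this
        simpa [upperRep_lineEquiv] using this
    · intro h
      have hgrad' := hasGradMeasure_map_iff.1 hgrad
      have : IsFiniteMeasure m := ⟨by
        have := hν.1
        rwa [measurableEmbedding_lineEquiv.map_apply, preimage_univ] at this⟩
      obtain ⟨n, θ', hnf, hn, hθm, hθ1, hgr⟩ : ∃ (n : Measure ℝ) (θ' : ℝ → ℝ), IsFiniteMeasure n ∧
          n (Ioo a b)ᶜ = 0 ∧ Measurable θ' ∧ (∀ x, θ' x = 1 ∨ θ' x = -1) ∧ ∀ φ, TestOn a b φ →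
          ∫ t in Ioo a b, u (lineEquiv t) * deriv φ t = - ∫ t, φ t * θ' t ∂n := by
        rcases exists_measurable_sign_or_integral_eq_zero hgrad'.2.1 hgrad'.1 hui hgrad'.2.2 with
          ⟨θ', hθm, hθ1, hθe⟩ | h0
        · refine ⟨m, θ', this, hgrad'.2.1, hθm, hθ1, fun φ hφ => ?_⟩
          rw [hgrad'.2.2 φ hφ]
          congr 1
          exact integral_congr_ae (hθe.mono fun t ht => by simp only [ht])
        · refine ⟨0, fun _ => 1, inferInstance, by simp, measurable_const, fun _ => Or.inl rfl,
            fun φ hφ => ?_⟩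
          rw [h0 φ hφ, integral_zero_measure, neg_zero]
      obtain ⟨σ, k, hσm, hσ1, hkf, hk, hpair⟩ :=
        exists_pairing_of_unimodalOn hab hn hθm hθ1 hui hgr h
      have hnL : LocFinOn {x : Eu 1 | a < x 0 ∧ x 0 < b} (n.map lineEquiv) :=
        locFinOn_map_iff.2 ⟨fun K _ _ => measure_lt_top n K, hn⟩
      have hnG : HasGradMeasure {x : Eu 1 | a < x 0 ∧ x 0 < b} u (n.map lineEquiv)
          (fun x => lineEquiv (θ' (x 0))) := by
        refine hasGradMeasure_map_iff.2 ⟨ae_of_all _ fun t => ?_, hn, fun φ hφ => ?_⟩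
        · rcases hθ1 t with h | h <;> simp [h]
        · simpa using hgr φ hφ
      obtain ⟨C, hC⟩ := hub
      refine ⟨⟨hu1.locallyIntegrableOn, _, _, hnL, hnG⟩,
        ⟨hC.1, fun K hK _ => ⟨C, ae_restrict_of_ae_restrict_of_subset hK hC.2⟩⟩,
        fun x => lineEquiv (σ (x 0)), k.map lineEquiv, ?_, fun φ hφ hφ0 => ?_, fun φ hφ => ?_,
        locFinOn_map_iff.2 ⟨fun K _ _ => measure_lt_top k K, hk⟩, _, _, hnL, hnG, fun φ hφ => ?_⟩
      · rw [Bdd, ← map_lineEquiv_restrict_Ioo, measurableEmbedding_lineEquiv.ae_map_iff,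
          measurableEmbedding_lineEquiv.aestronglyMeasurable_map_iff]
        simp only [norm_eq_abs_coord, Function.comp_def, lineEquiv_apply_zero]
        exact ⟨lineEquiv.continuous.comp_aestronglyMeasurable hσm.aestronglyMeasurable,
          (ae_restrict_iff' measurableSet_Ioo).2 (ae_of_all _ hσ1)⟩
      · rw [setIntegral_inner_gradient hφ]
        simp only [lineEquiv_apply_zero]
        rw [(hpair _ (isTest_iff_testOn.1 hφ)).1]
        exact integral_nonneg fun t => hφ0 _
      · rw [setIntegral_inner_gradient hφ, integral_map_lineEquiv, integral_zero_measure, sub_zero]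
        simp only [lineEquiv_apply_zero]
        exact (hpair _ (isTest_iff_testOn.1 hφ)).1
      · rw [setIntegral_mul_inner_gradient hφ, integral_map_lineEquiv, integral_map_lineEquiv]
        simp only [lineEquiv_apply_zero, upperRep_lineEquiv]
        exact (hpair _ (isTest_iff_testOn.1 hφ)).2
  have hcoord : ∀ x : Eu 1, upperRep u x = upperLim (fun t => u (lineEquiv t)) (x 0) := fun x => by
    rw [← upperRep_lineEquiv, lineEquiv_coord]
  rw [hmain]
  refine exists_congr fun c => and_congr_right fun _ => and_congr
    ⟨fun h x y hx hxy hy => ?_, fun h x y hx hxy hy => ?_⟩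
    ⟨fun h x y hx hxy hy => ?_, fun h x y hx hxy hy => ?_⟩
  · rw [hcoord, hcoord]
    exact h _ _ hx hxy hy
  · rw [← upperRep_lineEquiv, ← upperRep_lineEquiv]
    exact h _ _ (by simpa using hx) (by simpa using hxy) (by simpa using hy)
  · rw [hcoord, hcoord]
    exact h _ _ hx hxy hy
  · rw [← upperRep_lineEquiv, ← upperRep_lineEquiv]
    exact h _ _ (by simpa using hx) (by simpa using hxy) (by simpa using hy)
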